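/- arXiv:2107.09438 — 4 statements merged into one kernel-verified Lean document; each statement's English description precedes it below -/
import Mathlib

section
/- For every dimension d ≥ 1 and every s > 0 there exists a constant α_{s,d} > 0 depending only on (s, d) such that for every β > 0 and every integer N ≥ 2, ‖F_{N,s}‖_{L¹(𝕋^d)} ≤ 1 + α_{s,d} · (1 + β N²)^{-s/2} · (log(N+2))^d. -/
open MeasureTheory

noncomputable section

/-- The fundamental domain `[0,1)^d` of the torus `𝕋^d = (ℝ/ℤ)^d`. -/
def torusBox (d : ℕ) : Set (Fin d → ℝ) :=
  Set.univ.pi fun _ => Set.Ico (0 : ℝ) 1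

/-- The character `e^{2πi k·x}` on `𝕋^d`. -/
def torusChar (d : ℕ) (k : Fin d → ℤ) (x : Fin d → ℝ) : ℂ :=
  Complex.exp (2 * Real.pi * Complex.I * (∑ i, (k i : ℝ) * x i))

/-- The truncated Bessel kernel
`F_{N,s}(x) = ∑_{|k|_∞ ≤ N} (1 + 4π²β|k|²)^{-s/2} e^{2πik·x}`, the kernel of
`(Id − βΔ)^{-s/2} Π_N`. -/
def FNs (d : ℕ) (β s : ℝ) (N : ℕ) (x : Fin d → ℝ) : ℂ :=
  ∑ k ∈ Fintype.piFinset (fun _ : Fin d => Finset.Icc (-(N : ℤ)) (N : ℤ)),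
    (((1 + 4 * Real.pi ^ 2 * β * ∑ i, ((k i : ℝ)) ^ 2) ^ (-(s / 2)) : ℝ) : ℂ) *
      torusChar d k x

/-- The trigonometric polynomial `∑_{|k| ≤ n} e^{-ck²} e^{2πikx}`; for `c = 0` it is the
Dirichlet kernel, for `c > 0` a truncated heat kernel. -/
def gaussPoly (c : ℝ) (n : ℕ) (x : ℝ) : ℂ :=
  ∑ k ∈ Finset.Icc (-(n : ℤ)) n,
    ((Real.exp (-(c * (k : ℝ) ^ 2)) : ℝ) : ℂ) *
      Complex.exp (2 * Real.pi * Complex.I * ((k : ℝ) * x))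

theorem continuous_uncurry_gaussPoly (n : ℕ) :
    Continuous fun p : ℝ × ℝ => gaussPoly p.1 n p.2 := by
  unfold gaussPoly
  fun_prop

theorem continuous_gaussPoly (c : ℝ) (n : ℕ) : Continuous (gaussPoly c n) :=
  (continuous_uncurry_gaussPoly n).comp (by fun_prop : Continuous fun x : ℝ => (c, x))

theorem integrableOn_norm_gaussPoly (c : ℝ) (n : ℕ) :
    IntegrableOn (fun x => ‖gaussPoly c n x‖) (Set.Ico 0 1) :=
  ((continuous_gaussPoly c n).norm.continuousOn.integrableOn_Icc).mono_set Set.Ico_subset_Icc_self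

theorem norm_exp_two_pi_mul (k : ℤ) (x : ℝ) :
    ‖Complex.exp (2 * Real.pi * Complex.I * ((k : ℝ) * x))‖ = 1 := by
  have h : (2 * Real.pi * Complex.I * ((k : ℝ) * x) : ℂ) =
      ((2 * Real.pi * (k * x) : ℝ) : ℂ) * Complex.I := by
    push_cast; ring
  rw [h, Complex.norm_exp_ofReal_mul_I]

theorem norm_gauss_term (c : ℝ) (k : ℤ) (x : ℝ) :
    ‖((Real.exp (-(c * (k : ℝ) ^ 2)) : ℝ) : ℂ) *
      Complex.exp (2 * Real.pi * Complex.I * ((k : ℝ) * x))‖ = Real.exp (-(c * (k : ℝ) ^ 2)) := by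
  rw [norm_mul, norm_exp_two_pi_mul, mul_one, Complex.norm_real, Real.norm_eq_abs, Real.abs_exp]

theorem sum_Icc_neg_succ {M : Type*} [AddCommMonoid M] (f : ℤ → M) (n : ℕ) :
    ∑ k ∈ Finset.Icc (-((n + 1 : ℕ) : ℤ)) ((n + 1 : ℕ) : ℤ), f k =
      f (n + 1) + (f (-(n + 1)) + ∑ k ∈ Finset.Icc (-(n : ℤ)) n, f k) := by
  have h : Finset.Icc (-((n + 1 : ℕ) : ℤ)) ((n + 1 : ℕ) : ℤ) =
      insert ((n : ℤ) + 1) (insert (-((n : ℤ) + 1)) (Finset.Icc (-(n : ℤ)) n)) := by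
    ext k
    simp only [Finset.mem_Icc, Finset.mem_insert]
    omega
  rw [h, Finset.sum_insert, Finset.sum_insert]
  · simp only [Finset.mem_Icc]; omega
  · simp only [Finset.mem_Icc, Finset.mem_insert]; omega

theorem gaussPoly_succ_sub (c : ℝ) (n : ℕ) (x : ℝ) :
    gaussPoly c (n + 1) x - gaussPoly c n x =
      (Real.exp (-(c * ((n : ℝ) + 1) ^ 2)) : ℝ) * (gaussPoly 0 (n + 1) x - gaussPoly 0 n x) := by
  unfold gaussPoly
  rw [sum_Icc_neg_succ, sum_Icc_neg_succ]
  push_cast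
  simp only [zero_mul, neg_zero, Complex.exp_zero, one_mul]
  ring_nf

theorem gaussPoly_zero (c x : ℝ) : gaussPoly c 0 x = 1 := by simp [gaussPoly]

theorem norm_gaussPoly_le {c : ℝ} (hc : 0 ≤ c) (n : ℕ) (x : ℝ) :
    ‖gaussPoly c n x‖ ≤ 2 * n + 1 := by
  unfold gaussPoly
  refine (norm_sum_le _ _).trans ?_
  simp_rw [norm_gauss_term]
  refine (Finset.sum_le_card_nsmul _ _ 1 fun k _ => ?_).trans ?_
  · rw [Real.exp_le_one_iff]
    have := mul_nonneg hc (sq_nonneg (k : ℝ))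
    linarith
  · rw [Int.card_Icc, nsmul_eq_mul, mul_one]
    have : ((n : ℤ) + 1 - -(n : ℤ)).toNat = 2 * n + 1 := by omega
    rw [this]; push_cast; rfl

theorem dirichlet_mul_sin (n : ℕ) (x : ℝ) :
    gaussPoly 0 n x *
        (Complex.exp (Real.pi * x * Complex.I) - Complex.exp (-(Real.pi * x * Complex.I))) =
      Complex.exp ((2 * n + 1) * (Real.pi * x * Complex.I)) -
        Complex.exp (-((2 * n + 1) * (Real.pi * x * Complex.I))) := by
  induction n with
  | zero => simp [gaussPoly_zero]
  | succ n ih =>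
    have h : gaussPoly 0 (n + 1) x = Complex.exp (2 * (n + 1) * (Real.pi * x * Complex.I)) +
        (Complex.exp (-(2 * (n + 1) * (Real.pi * x * Complex.I))) + gaussPoly 0 n x) := by
      unfold gaussPoly
      rw [sum_Icc_neg_succ]
      simp only [zero_mul, neg_zero, Real.exp_zero, Complex.ofReal_one, one_mul]
      push_cast
      congr 2
      · ring_nf
      · congr 1; ring_nf
    rw [h, add_mul, add_mul, ih]
    simp only [mul_sub, ← Complex.exp_add]
    push_cast
    ring_nf

theorem norm_dirichlet_mul_sin_le (n : ℕ) (x : ℝ) :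
    ‖gaussPoly 0 n x‖ * |Real.sin (Real.pi * x)| ≤ 1 := by
  have h := congrArg norm (dirichlet_mul_sin n x)
  have h1 : ∀ y : ℝ, Complex.exp (y * Complex.I) - Complex.exp (-(y * Complex.I)) =
      ((2 * Real.sin y : ℝ) : ℂ) * Complex.I := by
    intro y
    rw [← neg_mul, Complex.exp_mul_I, Complex.exp_mul_I, Complex.cos_neg, Complex.sin_neg]
    push_cast; ring
  have h2 := h1 (Real.pi * x)
  have h3 := h1 ((2 * n + 1) * (Real.pi * x))
  push_cast at h2 h3
  rw [mul_assoc _ _ Complex.I] at h3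
  rw [h2, ← mul_assoc, h3] at h
  simp only [norm_mul, Complex.norm_I, mul_one, Complex.norm_ofNat] at h
  rw [← Complex.ofReal_mul, ← Complex.ofReal_sin] at h
  have h4 : (2 * (n : ℂ) + 1) * ((Real.pi * x : ℝ) : ℂ) =
      (((2 * n + 1) * (Real.pi * x) : ℝ) : ℂ) := by
    push_cast; ring
  rw [h4, ← Complex.ofReal_sin] at h
  simp only [Complex.norm_real, Real.norm_eq_abs] at h
  have := Real.abs_sin_le_one ((2 * n + 1) * (Real.pi * x))
  linarith

theorem two_mul_le_sin_pi_mul {x : ℝ} (h0 : 0 ≤ x) (h1 : x ≤ 1 / 2) :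
    2 * x ≤ Real.sin (Real.pi * x) := by
  have hp := Real.pi_pos
  have := Real.mul_le_sin (x := Real.pi * x) (by positivity) (by nlinarith)
  calc 2 * x = 2 / Real.pi * (Real.pi * x) := by field_simp
    _ ≤ _ := this

theorem norm_dirichlet_le {x : ℝ} (h0 : 0 ≤ x) (h1 : x ≤ 1) (n : ℕ) :
    ‖gaussPoly 0 n x‖ ≤ 2 / ((2 * (n : ℝ) + 1)⁻¹ + 2 * x) +
      2 / ((2 * (n : ℝ) + 1)⁻¹ + 2 * (1 - x)) := by
  have hA : 0 < (2 * (n : ℝ) + 1) := by positivity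
  have hn : ‖gaussPoly 0 n x‖ * (2 * (n : ℝ) + 1)⁻¹ ≤ 1 := by
    rw [← div_eq_mul_inv, div_le_one hA]
    exact norm_gaussPoly_le le_rfl n x
  have key : ∀ y : ℝ, 0 ≤ y → y ≤ 1 / 2 → Real.sin (Real.pi * x) = Real.sin (Real.pi * y) →
      ‖gaussPoly 0 n x‖ ≤ 2 / ((2 * (n : ℝ) + 1)⁻¹ + 2 * y) := by
    intro y hy0 hy1 hs
    rw [le_div_iff₀ (by positivity), mul_add]
    have h2 := norm_dirichlet_mul_sin_le n x
    have h3 := two_mul_le_sin_pi_mul hy0 hy1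
    rw [hs, abs_of_nonneg (by linarith)] at h2
    have := mul_le_mul_of_nonneg_left h3 (norm_nonneg (gaussPoly 0 n x))
    linarith
  have h1x : 0 ≤ 1 - x := by linarith
  rcases le_total x (1 / 2) with h | h
  · exact (key x h0 h rfl).trans (le_add_of_nonneg_right (by positivity))
  · refine (key (1 - x) h1x (by linarith) ?_).trans (le_add_of_nonneg_left (by positivity))
    rw [mul_sub, mul_one, Real.sin_pi_sub]

/-- The bound on the Lebesgue constants. -/
theorem integral_norm_dirichlet_le (n : ℕ) :
    ∫ x in Set.Ico (0 : ℝ) 1, ‖gaussPoly 0 n x‖ ≤ 4 * Real.log (n + 2) := by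
  set A : ℝ := 2 * (n : ℝ) + 1 with hAdef
  have hA : 0 < A := by positivity
  have hc : 0 < A⁻¹ := by positivity
  have hderiv : ∀ x ∈ Set.uIcc (0 : ℝ) 1, HasDerivAt
      (fun x => Real.log (A⁻¹ + 2 * x) - Real.log (A⁻¹ + 2 * (1 - x)))
      (2 / (A⁻¹ + 2 * x) + 2 / (A⁻¹ + 2 * (1 - x))) x := by
    intro x hx
    rw [Set.uIcc_of_le zero_le_one] at hx
    have hx0 := hx.1
    have hx1 : 0 ≤ 1 - x := by linarith [hx.2]
    have e1 : HasDerivAt (fun x => A⁻¹ + 2 * x) 2 x := by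
      simpa using ((hasDerivAt_id x).const_mul 2).const_add A⁻¹
    have e2 : HasDerivAt (fun x => A⁻¹ + 2 * (1 - x)) (-2) x := by
      simpa using (((hasDerivAt_id x).const_sub 1).const_mul 2).const_add A⁻¹
    convert! (e1.log (by positivity)).sub (e2.log (by positivity)) using 1
    ring
  have hcont : ContinuousOn (fun x : ℝ => 2 / (A⁻¹ + 2 * x) + 2 / (A⁻¹ + 2 * (1 - x)))
      (Set.uIcc 0 1) := by
    rw [Set.uIcc_of_le zero_le_one]
    refine ContinuousOn.add ?_ ?_ <;>
      refine ContinuousOn.div (by fun_prop) (by fun_prop) fun x hx => ?_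
    · have := hx.1
      positivity
    · have : 0 ≤ 1 - x := by linarith [hx.2]
      positivity
  have hftc := intervalIntegral.integral_eq_sub_of_hasDerivAt hderiv hcont.intervalIntegrable
  rw [integral_Ico_eq_integral_Ioc, ← intervalIntegral.integral_of_le zero_le_one]
  calc ∫ x in (0 : ℝ)..1, ‖gaussPoly 0 n x‖
      ≤ ∫ x in (0 : ℝ)..1, (2 / (A⁻¹ + 2 * x) + 2 / (A⁻¹ + 2 * (1 - x))) :=
        intervalIntegral.integral_mono_on zero_le_one
          ((continuous_gaussPoly 0 n).norm.intervalIntegrable _ _) hcont.intervalIntegrable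
          fun x hx => norm_dirichlet_le hx.1 hx.2 n
    _ = 2 * (Real.log (A⁻¹ + 2) - Real.log A⁻¹) := by rw [hftc]; norm_num; ring
    _ = 2 * Real.log (4 * n + 3) := by
        rw [← Real.log_div (by positivity) (by positivity)]
        congr 2
        rw [hAdef]; field_simp; ring
    _ ≤ 2 * Real.log (((n : ℝ) + 2) ^ 2) := by
        gcongr
        nlinarith [(Nat.cast_nonneg n : (0 : ℝ) ≤ n)]
    _ = 4 * Real.log (n + 2) := by rw [Real.log_pow]; push_cast; ring

theorem summable_exp_neg_mul_int_sq {c : ℝ} (hc : 0 < c) :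
    Summable fun k : ℤ => Real.exp (-(c * (k : ℝ) ^ 2)) := by
  have h := (summable_jacobiTheta₂_term_iff 0 (((c / Real.pi : ℝ) : ℂ) * Complex.I)).2
    (by simpa using div_pos hc Real.pi_pos)
  refine h.norm.congr fun k => ?_
  rw [norm_jacobiTheta₂_term]
  congr 1
  simp
  field_simp

theorem integral_exp_two_pi_mul {k : ℤ} (hk : k ≠ 0) :
    ∫ x in Set.Ico (0 : ℝ) 1, Complex.exp (2 * Real.pi * Complex.I * ((k : ℝ) * x)) = 0 := by
  rw [integral_Ico_eq_integral_Ioc, ← intervalIntegral.integral_of_le zero_le_one]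
  have hne : (2 * Real.pi * Complex.I * k : ℂ) ≠ 0 := by
    simp [hk, Real.pi_ne_zero]
  have h := integral_exp_mul_complex (a := 0) (b := 1) hne
  have h1 : Complex.exp (2 * Real.pi * Complex.I * k) = 1 := by
    rw [mul_comm]; exact Complex.exp_int_mul_two_pi_mul_I k
  simp only [Complex.ofReal_one, mul_one, h1, Complex.ofReal_zero, mul_zero, Complex.exp_zero,
    sub_self, zero_div] at h
  rw [← h]
  refine intervalIntegral.integral_congr fun x _ => congrArg Complex.exp ?_
  push_cast
  ring

theorem integral_gaussPoly (c : ℝ) (n : ℕ) :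
    ∫ x in Set.Ico (0 : ℝ) 1, gaussPoly c n x = 1 := by
  unfold gaussPoly
  rw [integral_finsetSum]
  · simp_rw [integral_const_mul]
    rw [Finset.sum_eq_single 0]
    · simp
    · intro k _ hk
      rw [integral_exp_two_pi_mul hk, mul_zero]
    · intro h
      simp at h
  · intro k _
    refine (Continuous.integrableOn_Icc ?_).mono_set Set.Ico_subset_Icc_self
    fun_prop

/-- Poisson summation: the periodic heat kernel is nonnegative. -/
theorem exists_tsum_gauss_eq_nonneg {c : ℝ} (hc : 0 < c) (x : ℝ) :
    ∃ r : ℝ, 0 ≤ r ∧ ∑' k : ℤ, ((Real.exp (-(c * (k : ℝ) ^ 2)) : ℝ) : ℂ) *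
      Complex.exp (2 * Real.pi * Complex.I * ((k : ℝ) * x)) = r := by
  have hp := Real.pi_pos
  set a : ℝ := c / Real.pi with ha
  have ha0 : 0 < a := by positivity
  have h := Complex.tsum_exp_neg_quadratic (a := (a : ℂ)) (by simpa using ha0) (Complex.I * x)
  refine ⟨1 / a ^ (1 / 2 : ℝ) * ∑' k : ℤ, Real.exp (-Real.pi / a * ((k : ℝ) - x) ^ 2),
    mul_nonneg (by positivity) (tsum_nonneg fun _ => (Real.exp_pos _).le), ?_⟩
  have e1 : ∀ k : ℤ, ((Real.exp (-(c * (k : ℝ) ^ 2)) : ℝ) : ℂ) *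
      Complex.exp (2 * Real.pi * Complex.I * ((k : ℝ) * x)) =
      Complex.exp (-Real.pi * a * k ^ 2 + 2 * Real.pi * (Complex.I * x) * k) := by
    intro k
    have : c = Real.pi * a := by rw [ha]; field_simp
    rw [this, Complex.ofReal_exp, ← Complex.exp_add]
    congr 1
    push_cast
    ring
  simp_rw [e1]
  rw [h]
  push_cast [Complex.ofReal_tsum, Complex.ofReal_cpow ha0.le]
  congr 1
  refine tsum_congr fun k => ?_
  congr 2
  rw [← mul_assoc, Complex.I_mul_I]
  ring

theorem tendsto_integral_norm_gaussPoly {c : ℝ} (hc : 0 < c) :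
    Filter.Tendsto (fun n => ∫ x in Set.Ico (0 : ℝ) 1, ‖gaussPoly c n x‖) Filter.atTop
      (nhds 1) := by
  have hsum := summable_exp_neg_mul_int_sq hc
  set S : ℝ := ∑' k : ℤ, Real.exp (-(c * (k : ℝ) ^ 2))
  choose r hr0 hr using exists_tsum_gauss_eq_nonneg hc
  have hlim : ∀ x, Filter.Tendsto (fun n => gaussPoly c n x) Filter.atTop (nhds (r x : ℂ)) := by
    intro x
    have hs : Summable fun k : ℤ => ((Real.exp (-(c * (k : ℝ) ^ 2)) : ℝ) : ℂ) *
        Complex.exp (2 * Real.pi * Complex.I * ((k : ℝ) * x)) :=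
      Summable.of_norm (hsum.congr fun k => (norm_gauss_term c k x).symm)
    have h := hs.hasSum
    rw [hr x] at h
    exact h.comp Finset.tendsto_Icc_neg
  have hbound : ∀ n x, ‖gaussPoly c n x‖ ≤ S := by
    intro n x
    unfold gaussPoly
    refine (norm_sum_le _ _).trans ?_
    simp_rw [norm_gauss_term]
    exact hsum.sum_le_tsum _ fun _ _ => (Real.exp_pos _).le
  have hint : Integrable (fun _ : ℝ => S) (volume.restrict (Set.Ico 0 1)) := by simp
  have h1 := tendsto_integral_of_dominated_convergence (μ := volume.restrict (Set.Ico (0 : ℝ) 1))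
    (F := fun n x => gaussPoly c n x) (f := fun x => (r x : ℂ)) (fun _ => S)
    (fun n => (continuous_gaussPoly c n).aestronglyMeasurable) hint
    (fun n => .of_forall (hbound n)) (.of_forall hlim)
  have h2 := tendsto_integral_of_dominated_convergence (μ := volume.restrict (Set.Ico (0 : ℝ) 1))
    (F := fun n x => ‖gaussPoly c n x‖) (f := r) (fun _ => S)
    (fun n => (continuous_gaussPoly c n).norm.aestronglyMeasurable) hint
    (fun n => .of_forall fun x => by rw [norm_norm]; exact hbound n x)
    (.of_forall fun x => by
      have := (hlim x).norm
      rwa [Complex.norm_real, Real.norm_eq_abs, abs_of_nonneg (hr0 x)] at this)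
  simp_rw [integral_gaussPoly] at h1
  have h3 := tendsto_nhds_unique h1 tendsto_const_nhds
  rw [integral_complex_ofReal, Complex.ofReal_eq_one] at h3
  rwa [h3] at h2

theorem one_le_log_add_two {n : ℕ} (hn : 1 ≤ n) : 1 ≤ Real.log ((n : ℝ) + 2) := by
  rw [Real.le_log_iff_exp_le (by positivity)]
  have : (1 : ℝ) ≤ n := by exact_mod_cast hn
  linarith [Real.exp_one_lt_d9]

theorem exp_neg_mul_sq_anti {c : ℝ} (hc : 0 ≤ c) (k : ℕ) :
    Real.exp (-(c * ((k : ℝ) + 1) ^ 2)) ≤ Real.exp (-(c * (k : ℝ) ^ 2)) := by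
  have : (k : ℝ) ^ 2 ≤ ((k : ℝ) + 1) ^ 2 := by gcongr; linarith
  have := mul_le_mul_of_nonneg_left this hc
  gcongr

/-- Summation by parts against the Dirichlet kernels. -/
theorem gaussPoly_sub_eq_sum (c : ℝ) {m n : ℕ} (h : m ≤ n) (x : ℝ) :
    (gaussPoly c n x - (Real.exp (-(c * (n : ℝ) ^ 2)) : ℝ) * gaussPoly 0 n x) -
      (gaussPoly c m x - (Real.exp (-(c * (m : ℝ) ^ 2)) : ℝ) * gaussPoly 0 m x) =
    ∑ k ∈ Finset.Ico m n, ((Real.exp (-(c * (k : ℝ) ^ 2)) -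
      Real.exp (-(c * ((k : ℝ) + 1) ^ 2)) : ℝ) : ℂ) * gaussPoly 0 k x := by
  induction n, h using Nat.le_induction with
  | base => simp
  | succ n h ih =>
    rw [Finset.sum_Ico_succ_top h, ← ih]
    have := gaussPoly_succ_sub c n x
    push_cast at this ⊢
    linear_combination this

theorem integral_norm_gaussPoly_sub_le {c : ℝ} (hc : 0 ≤ c) {m n : ℕ} (h : m ≤ n) :
    ∫ x in Set.Ico (0 : ℝ) 1,
      ‖(gaussPoly c n x - (Real.exp (-(c * (n : ℝ) ^ 2)) : ℝ) * gaussPoly 0 n x) -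
        (gaussPoly c m x - (Real.exp (-(c * (m : ℝ) ^ 2)) : ℝ) * gaussPoly 0 m x)‖ ≤
    ∑ k ∈ Finset.Ico m n, (Real.exp (-(c * (k : ℝ) ^ 2)) -
      Real.exp (-(c * ((k : ℝ) + 1) ^ 2))) * (4 * Real.log (k + 2)) := by
  have hd : ∀ k : ℕ, 0 ≤ Real.exp (-(c * (k : ℝ) ^ 2)) - Real.exp (-(c * ((k : ℝ) + 1) ^ 2)) :=
    fun k => sub_nonneg.2 (exp_neg_mul_sq_anti hc k)
  have hi : ∀ k ∈ Finset.Ico m n, IntegrableOn (fun x => (Real.exp (-(c * (k : ℝ) ^ 2)) -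
      Real.exp (-(c * ((k : ℝ) + 1) ^ 2))) * ‖gaussPoly 0 k x‖) (Set.Ico 0 1) :=
    fun k _ => (integrableOn_norm_gaussPoly 0 k).const_mul _
  simp_rw [gaussPoly_sub_eq_sum c h]
  calc _ ≤ ∫ x in Set.Ico (0 : ℝ) 1, ∑ k ∈ Finset.Ico m n, (Real.exp (-(c * (k : ℝ) ^ 2)) -
        Real.exp (-(c * ((k : ℝ) + 1) ^ 2))) * ‖gaussPoly 0 k x‖ := by
        refine integral_mono_of_nonneg (.of_forall fun x => norm_nonneg _)
          (integrable_finsetSum _ hi) (.of_forall fun x => ?_)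
        refine (norm_sum_le _ _).trans (le_of_eq (Finset.sum_congr rfl fun k _ => ?_))
        rw [norm_mul, Complex.norm_real, Real.norm_eq_abs, abs_of_nonneg (hd k)]
    _ ≤ _ := by
        rw [integral_finsetSum _ hi]
        refine Finset.sum_le_sum fun k _ => ?_
        rw [integral_const_mul]
        exact mul_le_mul_of_nonneg_left (integral_norm_dirichlet_le k) (hd k)

theorem sum_Ico_exp_neg_mul_sq_sub (c : ℝ) {m n : ℕ} (h : m ≤ n) :
    ∑ k ∈ Finset.Ico m n, (Real.exp (-(c * (k : ℝ) ^ 2)) - Real.exp (-(c * ((k : ℝ) + 1) ^ 2))) =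
      Real.exp (-(c * (m : ℝ) ^ 2)) - Real.exp (-(c * (n : ℝ) ^ 2)) := by
  induction n, h using Nat.le_induction with
  | base => simp
  | succ n h ih =>
    rw [Finset.sum_Ico_succ_top h, ih]
    push_cast
    ring

theorem integral_norm_gaussPoly_le_log {c : ℝ} (hc : 0 ≤ c) (n : ℕ) :
    ∫ x in Set.Ico (0 : ℝ) 1, ‖gaussPoly c n x‖ ≤ 4 * Real.log (n + 2) := by
  have h := integral_norm_gaussPoly_sub_le hc (Nat.zero_le n)
  set a : ℝ := Real.exp (-(c * (n : ℝ) ^ 2)) with ha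
  have ha0 : 0 ≤ a := (Real.exp_pos _).le
  simp only [CharP.cast_eq_zero, gaussPoly_zero, ne_eq, OfNat.ofNat_ne_zero, not_false_eq_true,
    zero_pow, mul_zero, neg_zero, Real.exp_zero, Complex.ofReal_one, mul_one, sub_self,
    sub_zero] at h
  have hi : IntegrableOn (fun x => ‖gaussPoly c n x - (a : ℂ) * gaussPoly 0 n x‖)
      (Set.Ico 0 1) := by
    refine (Continuous.integrableOn_Icc ?_).mono_set Set.Ico_subset_Icc_self
    have := continuous_gaussPoly c n
    have := continuous_gaussPoly 0 n
    fun_prop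
  have hD := (integrableOn_norm_gaussPoly 0 n).const_mul a
  calc _ ≤ ∫ x in Set.Ico (0 : ℝ) 1,
        (‖gaussPoly c n x - (a : ℂ) * gaussPoly 0 n x‖ + a * ‖gaussPoly 0 n x‖) := by
        refine integral_mono (integrableOn_norm_gaussPoly c n) (hi.add hD) fun x => ?_
        have := norm_add_le (gaussPoly c n x - (a : ℂ) * gaussPoly 0 n x)
          ((a : ℂ) * gaussPoly 0 n x)
        rwa [sub_add_cancel, norm_mul, Complex.norm_real, Real.norm_eq_abs,
          abs_of_nonneg ha0] at this
    _ ≤ ∑ k ∈ Finset.Ico 0 n, (Real.exp (-(c * (k : ℝ) ^ 2)) -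
          Real.exp (-(c * ((k : ℝ) + 1) ^ 2))) * (4 * Real.log (n + 2)) +
          a * (4 * Real.log (n + 2)) := by
        rw [integral_add hi hD, integral_const_mul]
        refine add_le_add (h.trans (Finset.sum_le_sum fun k hk => ?_))
          (mul_le_mul_of_nonneg_left (integral_norm_dirichlet_le n) ha0)
        have hkn : (k : ℝ) ≤ n := by exact_mod_cast (Finset.mem_Ico.1 hk).2.le
        refine mul_le_mul_of_nonneg_left ?_ (sub_nonneg.2 (exp_neg_mul_sq_anti hc k))
        gcongr
    _ = 4 * Real.log (n + 2) := by
        rw [← Finset.sum_mul, sum_Ico_exp_neg_mul_sq_sub c (Nat.zero_le n)]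
        simp [ha]
        ring

theorem exp_sub_mul_log_le {c : ℝ} {N k : ℕ} (hN : 1 ≤ N) (hk : N ≤ k)
    (hc : 1 ≤ c * (N : ℝ) ^ 2) :
    (Real.exp (-(c * (k : ℝ) ^ 2)) - Real.exp (-(c * ((k : ℝ) + 1) ^ 2))) * Real.log (k + 2) ≤
      (Real.exp (-(c / 2 * (k : ℝ) ^ 2)) -
        Real.exp (-(c / 2 * ((k : ℝ) + 1) ^ 2))) * (4 * Real.log (N + 2)) := by
  have hN' : (1 : ℝ) ≤ N := by exact_mod_cast hN
  have hk' : (N : ℝ) ≤ k := by exact_mod_cast hk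
  have hc0 : 0 < c := pos_of_mul_pos_left (one_pos.trans_le hc) (by positivity)
  have hL := one_le_log_add_two hN
  have hanti := exp_neg_mul_sq_anti (half_pos hc0).le k
  have hsq : ∀ y : ℝ, Real.exp (-(c * y ^ 2)) = Real.exp (-(c / 2 * y ^ 2)) ^ 2 := by
    intro y
    rw [← Real.exp_nat_mul]
    congr 1
    push_cast
    ring
  rw [hsq, hsq]
  set b := Real.exp (-(c / 2 * (k : ℝ) ^ 2)) with hb
  set b' := Real.exp (-(c / 2 * ((k : ℝ) + 1) ^ 2))
  have hb0 : 0 < b := Real.exp_pos _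
  have hb0' : 0 < b' := Real.exp_pos _
  have hb1 : b ≤ 1 := by
    rw [hb, Real.exp_le_one_iff, neg_nonpos]
    positivity
  have hlog : Real.log (k + 2) ≤ Real.log (N + 2) + (k : ℝ) / N := by
    have h1 : Real.log (((k : ℝ) + 2) / (N + 2)) ≤ ((k : ℝ) + 2) / (N + 2) - 1 :=
      Real.log_le_sub_one_of_pos (by positivity)
    rw [Real.log_div (by positivity) (by positivity)] at h1
    have h2 : ((k : ℝ) + 2) / (N + 2) ≤ k / N := by
      rw [div_le_div_iff₀ (by positivity) (by positivity)]
      nlinarith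
    linarith
  have hby : b * ((k : ℝ) / N) ≤ 1 := by
    set y := (k : ℝ) / N with hy
    have hky : (k : ℝ) = N * y := by rw [hy]; field_simp
    have h1 : y ^ 2 ≤ c * (k : ℝ) ^ 2 := by
      rw [hky, mul_pow, ← mul_assoc]
      exact le_mul_of_one_le_left (sq_nonneg y) hc
    have h2 := Real.add_one_le_exp (c / 2 * (k : ℝ) ^ 2)
    have h3 : y ≤ Real.exp (c / 2 * (k : ℝ) ^ 2) := by nlinarith [sq_nonneg (y - 1)]
    rw [hb, Real.exp_neg, inv_mul_le_iff₀ (Real.exp_pos _), mul_one]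
    exact h3
  have hlog0 : 0 ≤ Real.log ((k : ℝ) + 2) := Real.log_nonneg (by linarith)
  rw [sq_sub_sq, mul_comm (b + b'), mul_assoc]
  refine mul_le_mul_of_nonneg_left ?_ (sub_nonneg.2 hanti)
  calc (b + b') * Real.log (k + 2) ≤ (2 * b) * (Real.log (N + 2) + (k : ℝ) / N) := by
        gcongr
        linarith
    _ = 2 * (b * Real.log (N + 2)) + 2 * (b * ((k : ℝ) / N)) := by ring
    _ ≤ 4 * Real.log (N + 2) := by
        have := mul_le_of_le_one_left (by linarith : 0 ≤ Real.log ((N : ℝ) + 2)) hb1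
        linarith

theorem tendsto_exp_neg_mul_sq_mul {c : ℝ} (hc : 0 < c) :
    Filter.Tendsto (fun n : ℕ => Real.exp (-(c * (n : ℝ) ^ 2)) * (2 * n + 1)) Filter.atTop
      (nhds 0) := by
  refine squeeze_zero' (.of_forall fun n => by positivity) ?_
    (tendsto_const_div_atTop_nhds_zero_nat (3 / c))
  filter_upwards [Filter.eventually_ge_atTop 1] with n hn
  have hn' : (1 : ℝ) ≤ n := by exact_mod_cast hn
  have h := Real.add_one_le_exp (c * (n : ℝ) ^ 2)
  rw [Real.exp_neg, inv_mul_le_iff₀ (Real.exp_pos _)]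
  calc 2 * (n : ℝ) + 1 ≤ 3 * n := by linarith
    _ = c * (n : ℝ) ^ 2 * (3 / c / n) := by field_simp
    _ ≤ _ := by gcongr; linarith

/-- The one-dimensional estimate for the truncated heat kernel. -/
theorem integral_norm_gaussPoly_le {c : ℝ} (hc : 0 < c) {N : ℕ} (hN : 1 ≤ N) :
    ∫ x in Set.Ico (0 : ℝ) 1, ‖gaussPoly c N x‖ ≤
      1 + 20 * Real.log (N + 2) * Real.exp (-(c / 2 * (N : ℝ) ^ 2)) := by
  have hL := one_le_log_add_two hN
  rcases le_total (c * (N : ℝ) ^ 2) 1 with hcN | hcN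
  · refine (integral_norm_gaussPoly_le_log hc.le N).trans ?_
    have h := Real.add_one_le_exp (-(c / 2 * (N : ℝ) ^ 2))
    have h2 : 1 / 2 ≤ Real.exp (-(c / 2 * (N : ℝ) ^ 2)) := by linarith
    nlinarith
  · set B := Real.exp (-(c / 2 * (N : ℝ) ^ 2)) with hB
    have hB0 : 0 < B := Real.exp_pos _
    have hAB : Real.exp (-(c * (N : ℝ) ^ 2)) ≤ B := by
      rw [hB, Real.exp_le_exp]; linarith
    have key : ∀ M : ℕ, N ≤ M → ∫ x in Set.Ico (0 : ℝ) 1, ‖gaussPoly c N x‖ ≤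
        (∫ x in Set.Ico (0 : ℝ) 1, ‖gaussPoly c M x‖) +
          Real.exp (-(c * (M : ℝ) ^ 2)) * (2 * M + 1) + 20 * Real.log (N + 2) * B := by
      intro M hM
      have hsub := integral_norm_gaussPoly_sub_le hc.le hM
      set a := Real.exp (-(c * (M : ℝ) ^ 2))
      set A := Real.exp (-(c * (N : ℝ) ^ 2))
      have ha0 : 0 < a := Real.exp_pos _
      have hA0 : 0 < A := Real.exp_pos _
      set R : ℝ → ℂ := fun x => (gaussPoly c M x - (a : ℂ) * gaussPoly 0 M x) -
        (gaussPoly c N x - (A : ℂ) * gaussPoly 0 N x) with hR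
      have hiR : IntegrableOn (fun x => ‖R x‖) (Set.Ico 0 1) := by
        refine (Continuous.integrableOn_Icc ?_).mono_set Set.Ico_subset_Icc_self
        have := continuous_gaussPoly c M
        have := continuous_gaussPoly 0 M
        have := continuous_gaussPoly c N
        have := continuous_gaussPoly 0 N
        fun_prop
      have hi1 := integrableOn_norm_gaussPoly c M
      have hi2 : IntegrableOn (fun _ => a * (2 * (M : ℝ) + 1)) (Set.Ico (0 : ℝ) 1) :=
        integrable_const _
      have hi3 := (integrableOn_norm_gaussPoly 0 N).const_mul A
      have hi12 : IntegrableOn (fun x => ‖gaussPoly c M x‖ + a * (2 * (M : ℝ) + 1))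
        (Set.Ico (0 : ℝ) 1) := hi1.add hi2
      have hi123 : IntegrableOn (fun x => ‖gaussPoly c M x‖ + a * (2 * (M : ℝ) + 1) +
        A * ‖gaussPoly 0 N x‖) (Set.Ico (0 : ℝ) 1) := hi12.add hi3
      have hle : ∫ x in Set.Ico (0 : ℝ) 1, ‖gaussPoly c N x‖ ≤ ∫ x in Set.Ico (0 : ℝ) 1,
          (‖gaussPoly c M x‖ + a * (2 * M + 1) + A * ‖gaussPoly 0 N x‖ + ‖R x‖) := by
        refine integral_mono (integrableOn_norm_gaussPoly c N) (hi123.add hiR) fun x => ?_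
        have hx : gaussPoly c N x = gaussPoly c M x - (a : ℂ) * gaussPoly 0 M x +
            (A : ℂ) * gaussPoly 0 N x - R x := by
          rw [hR]; ring
        have h1 := norm_gaussPoly_le le_rfl (c := 0) M x
        have h2 : ‖(a : ℂ) * gaussPoly 0 M x‖ ≤ a * (2 * M + 1) := by
          rw [norm_mul, Complex.norm_real, Real.norm_eq_abs, abs_of_pos ha0]
          gcongr
        have h3 : ‖(A : ℂ) * gaussPoly 0 N x‖ = A * ‖gaussPoly 0 N x‖ := by
          rw [norm_mul, Complex.norm_real, Real.norm_eq_abs, abs_of_pos hA0]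
        change ‖gaussPoly c N x‖ ≤ _
        rw [hx]
        refine (norm_sub_le _ _).trans (add_le_add_left ?_ _)
        refine (norm_add_le _ _).trans (add_le_add ?_ h3.le)
        exact (norm_sub_le _ _).trans (add_le_add_right h2 _)
      have hconst : ∫ _ in Set.Ico (0 : ℝ) 1, a * (2 * (M : ℝ) + 1) = a * (2 * M + 1) := by simp
      rw [integral_add hi123 hiR, integral_add hi12 hi3, integral_add hi1 hi2, hconst,
        integral_const_mul] at hle
      have hD := mul_le_mul hAB (integral_norm_dirichlet_le N)
        (integral_nonneg fun _ => norm_nonneg _) hB0.le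
      have hsum : ∑ k ∈ Finset.Ico N M, (Real.exp (-(c * (k : ℝ) ^ 2)) -
          Real.exp (-(c * ((k : ℝ) + 1) ^ 2))) * (4 * Real.log (k + 2)) ≤
          16 * Real.log (N + 2) * B := by
        calc _ ≤ ∑ k ∈ Finset.Ico N M, (Real.exp (-(c / 2 * (k : ℝ) ^ 2)) -
              Real.exp (-(c / 2 * ((k : ℝ) + 1) ^ 2))) * (16 * Real.log (N + 2)) := by
              refine Finset.sum_le_sum fun k hk => ?_
              linarith [exp_sub_mul_log_le hN (Finset.mem_Ico.1 hk).1 hcN]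
          _ = (B - Real.exp (-(c / 2 * (M : ℝ) ^ 2))) * (16 * Real.log (N + 2)) := by
              rw [← Finset.sum_mul, sum_Ico_exp_neg_mul_sq_sub (c / 2) hM]
          _ ≤ B * (16 * Real.log (N + 2)) := by
              gcongr
              exact sub_le_self _ (Real.exp_pos _).le
          _ = _ := by ring
      linarith
    have hlim := ((tendsto_integral_norm_gaussPoly hc).add
      (tendsto_exp_neg_mul_sq_mul hc)).add_const (20 * Real.log (N + 2) * B)
    rw [add_zero] at hlim
    exact ge_of_tendsto hlim ((Filter.eventually_ge_atTop N).mono key)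

/-- The density of the Gamma distribution of shape `a` and rate `1`. -/
def gammaWeight (a t : ℝ) : ℝ := t ^ (a - 1) * Real.exp (-t) / Real.Gamma a

theorem gammaWeight_nonneg {a t : ℝ} (ha : 0 < a) (ht : 0 < t) : 0 ≤ gammaWeight a t := by
  have := Real.Gamma_pos_of_pos ha
  unfold gammaWeight
  positivity

theorem measurable_gammaWeight (a : ℝ) : Measurable (gammaWeight a) := by
  unfold gammaWeight
  fun_prop

theorem integral_gammaWeight_mul_exp {a X : ℝ} (ha : 0 < a) (hX : 0 ≤ X) :
    ∫ t in Set.Ioi (0 : ℝ), gammaWeight a t * Real.exp (-(X * t)) = (1 + X) ^ (-a) := by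
  have hX1 : 0 < 1 + X := by linarith
  have h := Real.integral_rpow_mul_exp_neg_mul_Ioi ha hX1
  have hG := (Real.Gamma_pos_of_pos ha).ne'
  have e : ∀ t : ℝ, gammaWeight a t * Real.exp (-(X * t)) =
      t ^ (a - 1) * Real.exp (-((1 + X) * t)) / Real.Gamma a := by
    intro t
    have : Real.exp (-((1 + X) * t)) = Real.exp (-t) * Real.exp (-(X * t)) := by
      rw [← Real.exp_add]; congr 1; ring
    rw [this, gammaWeight]
    ring
  simp_rw [e]
  rw [integral_div, h, mul_div_assoc, div_self hG, mul_one, one_div, Real.inv_rpow hX1.le,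
    Real.rpow_neg hX1.le]

theorem integrableOn_gammaWeight_mul_exp {a X : ℝ} (ha : 0 < a) (hX : 0 ≤ X) :
    IntegrableOn (fun t => gammaWeight a t * Real.exp (-(X * t))) (Set.Ioi 0) := by
  refine Integrable.of_integral_ne_zero ?_
  rw [integral_gammaWeight_mul_exp ha hX]
  exact (Real.rpow_pos_of_pos (by linarith) _).ne'

theorem integrableOn_gammaWeight {a : ℝ} (ha : 0 < a) :
    IntegrableOn (gammaWeight a) (Set.Ioi 0) := by
  simpa using integrableOn_gammaWeight_mul_exp ha le_rfl

theorem integral_gammaWeight {a : ℝ} (ha : 0 < a) :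
    ∫ t in Set.Ioi (0 : ℝ), gammaWeight a t = 1 := by
  simpa using integral_gammaWeight_mul_exp ha le_rfl

theorem prod_gaussPoly (d : ℕ) (c : ℝ) (N : ℕ) (x : Fin d → ℝ) :
    ∏ i, gaussPoly c N (x i) =
      ∑ k ∈ Fintype.piFinset (fun _ : Fin d => Finset.Icc (-(N : ℤ)) (N : ℤ)),
        ((Real.exp (-(c * ∑ i, (k i : ℝ) ^ 2)) : ℝ) : ℂ) * torusChar d k x := by
  unfold gaussPoly torusChar
  rw [Finset.prod_univ_sum]
  refine Finset.sum_congr rfl fun k _ => ?_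
  rw [Finset.prod_mul_distrib]
  congr 1
  · rw [← Complex.ofReal_prod, ← Real.exp_sum, Finset.sum_neg_distrib, ← Finset.mul_sum]
  · rw [← Complex.exp_sum, ← Finset.mul_sum]
    push_cast
    rfl

/-- Subordination of the truncated Bessel kernel to truncated heat kernels. -/
theorem FNs_eq_integral (d : ℕ) {β s : ℝ} (hβ : 0 < β) (hs : 0 < s) (N : ℕ) (x : Fin d → ℝ) :
    FNs d β s N x = ∫ t in Set.Ioi (0 : ℝ),
      (gammaWeight (s / 2) t : ℂ) * ∏ i, gaussPoly (4 * Real.pi ^ 2 * β * t) N (x i) := by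
  have hs2 : 0 < s / 2 := by positivity
  have hX : ∀ k : Fin d → ℤ, 0 ≤ 4 * Real.pi ^ 2 * β * ∑ i, (k i : ℝ) ^ 2 := fun k => by positivity
  have e : ∀ t : ℝ,
      (gammaWeight (s / 2) t : ℂ) * ∏ i, gaussPoly (4 * Real.pi ^ 2 * β * t) N (x i) =
      ∑ k ∈ Fintype.piFinset (fun _ : Fin d => Finset.Icc (-(N : ℤ)) (N : ℤ)),
        ((gammaWeight (s / 2) t *
          Real.exp (-((4 * Real.pi ^ 2 * β * ∑ i, (k i : ℝ) ^ 2) * t)) : ℝ) : ℂ) *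
          torusChar d k x := by
    intro t
    rw [prod_gaussPoly, Finset.mul_sum]
    refine Finset.sum_congr rfl fun k _ => ?_
    rw [Complex.ofReal_mul, mul_right_comm _ (∑ i, (k i : ℝ) ^ 2) t,
      mul_assoc (gammaWeight (s / 2) t : ℂ)]
  simp_rw [e]
  rw [integral_finsetSum]
  · unfold FNs
    refine Finset.sum_congr rfl fun k _ => ?_
    rw [integral_mul_const, integral_complex_ofReal, integral_gammaWeight_mul_exp hs2 (hX k)]
  · intro k _
    exact ((integrableOn_gammaWeight_mul_exp hs2 (hX k)).ofReal).mul_const _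

theorem integral_torusBox_prod (d : ℕ) (f : ℝ → ℝ) :
    ∫ x in torusBox d, ∏ i, f (x i) = (∫ x in Set.Ico (0 : ℝ) 1, f x) ^ d := by
  unfold torusBox
  rw [volume_pi, Measure.restrict_pi_pi, integral_fintype_prod_eq_prod (fun _ => f)]
  simp

theorem volume_torusBox (d : ℕ) : volume (torusBox d) = 1 := by
  simp [torusBox, volume_pi, Measure.pi_pi]

theorem integrable_gammaWeight_mul_prod (d : ℕ) {β a : ℝ} (hβ : 0 < β) (ha : 0 < a) (N : ℕ) :
    Integrable (fun p : (Fin d → ℝ) × ℝ =>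
      gammaWeight a p.2 * ∏ i, ‖gaussPoly (4 * Real.pi ^ 2 * β * p.2) N (p.1 i)‖)
      ((volume.restrict (torusBox d)).prod (volume.restrict (Set.Ioi 0))) := by
  have : IsFiniteMeasure (volume.restrict (torusBox d)) :=
    ⟨by simp [volume_torusBox]⟩
  have hw : Integrable (gammaWeight a) (volume.restrict (Set.Ioi 0)) := integrableOn_gammaWeight ha
  refine ((hw.comp_snd (volume.restrict (torusBox d))).mul_const ((2 * (N : ℝ) + 1) ^ d)).mono'
    ?_ ?_
  · refine ((measurable_gammaWeight a).comp measurable_snd).aestronglyMeasurable.mul ?_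
    refine (continuous_finsetProd _ fun i _ => ?_).aestronglyMeasurable
    exact ((continuous_uncurry_gaussPoly N).comp (by fun_prop :
      Continuous fun p : (Fin d → ℝ) × ℝ => (4 * Real.pi ^ 2 * β * p.2, p.1 i))).norm
  · have hpos : ∀ᵐ t ∂(volume.restrict (Set.Ioi (0 : ℝ))), 0 < t :=
      ae_restrict_mem measurableSet_Ioi
    filter_upwards [Measure.quasiMeasurePreserving_snd.ae hpos] with p hp
    have hw0 := gammaWeight_nonneg ha hp
    rw [Real.norm_eq_abs, abs_of_nonneg (mul_nonneg hw0 (by positivity))]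
    refine mul_le_mul_of_nonneg_left ?_ hw0
    have hc : 0 ≤ 4 * Real.pi ^ 2 * β * p.2 := by positivity
    refine (Finset.prod_le_prod (fun i _ => norm_nonneg _)
      fun i _ => norm_gaussPoly_le hc N (p.1 i)).trans (by simp)

theorem integral_norm_FNs_le (d : ℕ) {β s : ℝ} (hβ : 0 < β) (hs : 0 < s) (N : ℕ) :
    ∫ x in torusBox d, ‖FNs d β s N x‖ ≤ ∫ t in Set.Ioi (0 : ℝ), gammaWeight (s / 2) t *
      (∫ x in Set.Ico (0 : ℝ) 1, ‖gaussPoly (4 * Real.pi ^ 2 * β * t) N x‖) ^ d := by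
  have hint := integrable_gammaWeight_mul_prod d hβ (half_pos hs) N
  calc _ ≤ ∫ x in torusBox d, ∫ t in Set.Ioi (0 : ℝ), gammaWeight (s / 2) t *
        ∏ i, ‖gaussPoly (4 * Real.pi ^ 2 * β * t) N (x i)‖ := by
        refine integral_mono_of_nonneg (.of_forall fun x => norm_nonneg _)
          hint.integral_prod_left (.of_forall fun x => ?_)
        beta_reduce
        rw [FNs_eq_integral d hβ hs]
        refine (norm_integral_le_integral_norm _).trans (le_of_eq ?_)
        refine setIntegral_congr_fun measurableSet_Ioi fun t ht => ?_
        rw [norm_mul, norm_prod, Complex.norm_real, Real.norm_eq_abs,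
          abs_of_nonneg (gammaWeight_nonneg (half_pos hs) ht)]
    _ = ∫ t in Set.Ioi (0 : ℝ), ∫ x in torusBox d, gammaWeight (s / 2) t *
        ∏ i, ‖gaussPoly (4 * Real.pi ^ 2 * β * t) N (x i)‖ := integral_integral_swap hint
    _ = _ := by
        refine integral_congr_ae (.of_forall fun t => ?_)
        simp only
        rw [integral_const_mul,
          integral_torusBox_prod d fun x => ‖gaussPoly (4 * Real.pi ^ 2 * β * t) N x‖]

theorem one_add_mul_pow_le (d : ℕ) {y E : ℝ} (hy : 0 ≤ y) (hE0 : 0 ≤ E) (hE1 : E ≤ 1) :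
    (1 + y * E) ^ d ≤ 1 + (1 + y) ^ d * E := by
  have h := (convexOn_pow d).2 (Set.mem_Ici.2 zero_le_one)
    (Set.mem_Ici.2 (by linarith : 0 ≤ 1 + y)) (sub_nonneg.2 hE1) hE0 (by ring)
  simp only [smul_eq_mul, one_pow, mul_one] at h
  calc (1 + y * E) ^ d = (1 - E + E * (1 + y)) ^ d := by ring
    _ ≤ 1 - E + E * (1 + y) ^ d := h
    _ ≤ _ := by linarith

theorem pow_integral_norm_gaussPoly_le (d : ℕ) {c : ℝ} (hc : 0 < c) {N : ℕ} (hN : 1 ≤ N) :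
    (∫ x in Set.Ico (0 : ℝ) 1, ‖gaussPoly c N x‖) ^ d ≤
      1 + 21 ^ d * Real.log (N + 2) ^ d * Real.exp (-(c / 2 * (N : ℝ) ^ 2)) := by
  have hL := one_le_log_add_two hN
  have hE : Real.exp (-(c / 2 * (N : ℝ) ^ 2)) ≤ 1 := by
    rw [Real.exp_le_one_iff, neg_nonpos]
    positivity
  calc _ ≤ (1 + 20 * Real.log (N + 2) * Real.exp (-(c / 2 * (N : ℝ) ^ 2))) ^ d :=
        pow_le_pow_left₀ (integral_nonneg fun _ => norm_nonneg _)
          (integral_norm_gaussPoly_le hc hN) d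
    _ ≤ 1 + (1 + 20 * Real.log (N + 2)) ^ d * Real.exp (-(c / 2 * (N : ℝ) ^ 2)) :=
        one_add_mul_pow_le d (by linarith) (Real.exp_pos _).le hE
    _ ≤ _ := by
        rw [← mul_pow]
        gcongr
        linarith

/-- For every dimension `d ≥ 1` and every `s > 0` there is a constant
`α_{s,d} > 0` depending only on `(s,d)` such that for every `β > 0` and integer `N ≥ 2`,
`‖F_{N,s}‖_{L¹(𝕋^d)} ≤ 1 + α_{s,d} (1 + βN²)^{-s/2} (log (N+2))^d`. -/
theorem statement3 (d : ℕ) (hd : 1 ≤ d) (s : ℝ) (hs : 0 < s) :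
    ∃ α : ℝ, 0 < α ∧
      ∀ β : ℝ, 0 < β → ∀ N : ℕ, 2 ≤ N →
        (∫ x in torusBox d, ‖FNs d β s N x‖)
          ≤ 1 + α * (1 + β * (N : ℝ) ^ 2) ^ (-(s / 2)) * Real.log ((N : ℝ) + 2) ^ d := by
  refine ⟨21 ^ d, by positivity, fun β hβ N hN => ?_⟩
  have hN1 : 1 ≤ N := by omega
  have hs2 : 0 < s / 2 := half_pos hs
  set K : ℝ := 21 ^ d * Real.log (N + 2) ^ d with hK
  have hL := one_le_log_add_two hN1
  have hK0 : 0 ≤ K := by positivity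
  set X : ℝ := 2 * Real.pi ^ 2 * β * (N : ℝ) ^ 2 with hX
  have hX0 : 0 ≤ X := by positivity
  have hw : IntegrableOn (gammaWeight (s / 2)) (Set.Ioi 0) := integrableOn_gammaWeight hs2
  have hwX := (integrableOn_gammaWeight_mul_exp hs2 hX0).const_mul K
  calc _ ≤ _ := integral_norm_FNs_le d hβ hs N
    _ ≤ ∫ t in Set.Ioi (0 : ℝ), (gammaWeight (s / 2) t +
          K * (gammaWeight (s / 2) t * Real.exp (-(X * t)))) := by
        have hnn : ∀ᵐ t ∂(volume.restrict (Set.Ioi (0 : ℝ))), 0 < t :=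
          ae_restrict_mem measurableSet_Ioi
        refine integral_mono_of_nonneg ?_ (hw.add hwX) ?_
        · filter_upwards [hnn] with t ht
          exact mul_nonneg (gammaWeight_nonneg hs2 ht)
            (pow_nonneg (integral_nonneg fun _ => norm_nonneg _) d)
        · filter_upwards [hnn] with t ht
          have hw0 := gammaWeight_nonneg hs2 ht
          have h := pow_integral_norm_gaussPoly_le d
            (by positivity : 0 < 4 * Real.pi ^ 2 * β * t) hN1
          have hexp : 4 * Real.pi ^ 2 * β * t / 2 * (N : ℝ) ^ 2 = X * t := by rw [hX]; ring
          rw [hexp] at h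
          refine (mul_le_mul_of_nonneg_left h hw0).trans (le_of_eq ?_)
          ring
    _ = 1 + K * (1 + X) ^ (-(s / 2)) := by
        rw [integral_add hw hwX, integral_gammaWeight hs2, integral_const_mul,
          integral_gammaWeight_mul_exp hs2 hX0]
    _ ≤ 1 + K * (1 + β * (N : ℝ) ^ 2) ^ (-(s / 2)) := by
        have hXle : β * (N : ℝ) ^ 2 ≤ X := by
          rw [hX, mul_assoc (2 * Real.pi ^ 2)]
          refine le_mul_of_one_le_left (by positivity) ?_
          nlinarith [Real.pi_gt_three]
        have := Real.rpow_le_rpow_of_nonpos (by positivity : 0 < 1 + β * (N : ℝ) ^ 2)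
          (by linarith : 1 + β * (N : ℝ) ^ 2 ≤ 1 + X) (by linarith : -(s / 2) ≤ 0)
        gcongr
    _ = _ := by rw [hK]; ring

end
end

section
/- Define f₁(s) = ∫₀^{3π/2} ξ^{1−s} sin ξ dξ for s ∈ [0,1]. Then f₁(0) = −1, f₁(1) = 1, f₁ is differentiable on (0,1) with f₁′(s) ≥ 1/2 for all s ∈ (0,1), and there exists a unique s_* ∈ (0.308443, 0.308444) with f₁(s_*) = 0; moreover f₁(s) < 0 for 0 ≤ s < s_* and f₁(s) > 0 for s_* < s ≤ 1. -/
open MeasureTheory intervalIntegral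

noncomputable section

/-- `f₁(s) = ∫₀^{3π/2} ξ^{1-s} sin ξ dξ`. -/
def fOne (s : ℝ) : ℝ :=
  ∫ ξ in (0 : ℝ)..(3 * Real.pi / 2), ξ ^ (1 - s) * Real.sin ξ

theorem Complex.sum_range_two_mul_mul_I_pow_div_factorial (x : ℝ) (n : ℕ) :
    ∑ m ∈ Finset.range (2 * n), ((x : ℂ) * Complex.I) ^ m / m.factorial =
      ((∑ k ∈ Finset.range n, (-1) ^ k * x ^ (2 * k) / (2 * k).factorial : ℝ) : ℂ) +
      ((∑ k ∈ Finset.range n, (-1) ^ k * x ^ (2 * k + 1) / (2 * k + 1).factorial : ℝ) : ℂ) *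
        Complex.I := by
  induction n with
  | zero => simp
  | succ n ih =>
    rw [show 2 * (n + 1) = 2 * n + 1 + 1 by ring, Finset.sum_range_succ, Finset.sum_range_succ, ih,
      Finset.sum_range_succ, Finset.sum_range_succ]
    push_cast
    rw [mul_pow, mul_pow, pow_succ Complex.I, pow_mul Complex.I, Complex.I_sq]
    ring

theorem Complex.norm_exp_mul_I_sub_sum_le {x : ℝ} {n : ℕ} (hx : |x| ≤ n) :
    ‖Complex.exp (x * Complex.I) -
      ∑ m ∈ Finset.range (2 * n), ((x : ℂ) * Complex.I) ^ m / m.factorial‖ ≤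
      |x| ^ (2 * n) / (2 * n).factorial * 2 := by
  have hnorm : ‖(x : ℂ) * Complex.I‖ = |x| := by simp
  have h := Complex.exp_bound' (x := (x : ℂ) * Complex.I) (n := 2 * n) (by
    rw [hnorm, div_le_iff₀ (by positivity)]
    push_cast
    linarith)
  rwa [hnorm] at h

theorem Real.abs_cos_sub_sum_le {x : ℝ} {n : ℕ} (hx : |x| ≤ n) :
    |Real.cos x - ∑ k ∈ Finset.range n, (-1) ^ k * x ^ (2 * k) / (2 * k).factorial| ≤
      |x| ^ (2 * n) / (2 * n).factorial * 2 := by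
  refine le_trans (le_of_eq ?_)
    ((Complex.abs_re_le_norm _).trans (Complex.norm_exp_mul_I_sub_sum_le hx))
  rw [Complex.sum_range_two_mul_mul_I_pow_div_factorial, Complex.sub_re,
    Complex.exp_ofReal_mul_I_re, Complex.add_re, Complex.re_ofReal_mul, Complex.ofReal_re,
    Complex.I_re, mul_zero, add_zero]

theorem Real.abs_sin_sub_sum_le {x : ℝ} {n : ℕ} (hx : |x| ≤ n) :
    |Real.sin x - ∑ k ∈ Finset.range n, (-1) ^ k * x ^ (2 * k + 1) / (2 * k + 1).factorial| ≤
      |x| ^ (2 * n) / (2 * n).factorial * 2 := by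
  refine le_trans (le_of_eq ?_)
    ((Complex.abs_im_le_norm _).trans (Complex.norm_exp_mul_I_sub_sum_le hx))
  rw [Complex.sum_range_two_mul_mul_I_pow_div_factorial, Complex.sub_im,
    Complex.exp_ofReal_mul_I_im, Complex.add_im, Complex.im_ofReal_mul, Complex.ofReal_im,
    Complex.I_im, mul_one, zero_add]

theorem intervalIntegrable_rpow_mul_continuous {s a b : ℝ} (hs : s < 2) {g : ℝ → ℝ}
    (hg : Continuous g) :
    IntervalIntegrable (fun x : ℝ => x ^ (1 - s) * g x) volume a b :=
  (intervalIntegrable_rpow' (by linarith)).mul_continuousOn hg.continuousOn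

theorem integral_rpow_mul_pow {s a : ℝ} (hs : s < 2) (ha : 0 < a) (m : ℕ) :
    ∫ x in (0 : ℝ)..a, x ^ (1 - s) * x ^ m = a ^ (2 - s) * (a ^ m / (m + 2 - s)) := by
  have hm : (0 : ℝ) ≤ m := m.cast_nonneg
  have h : ∫ x in (0 : ℝ)..a, x ^ (1 - s) * x ^ m = ∫ x in (0 : ℝ)..a, x ^ (1 - s + m) := by
    refine integral_congr_ae (Filter.Eventually.of_forall fun x hx => ?_)
    rw [Set.uIoc_of_le ha.le] at hx
    rw [Real.rpow_add hx.1, Real.rpow_natCast]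
  rw [h, integral_rpow (Or.inl (by linarith)), Real.zero_rpow (by linarith), sub_zero,
    show 1 - s + m + 1 = 2 - s + m by ring, Real.rpow_add ha, Real.rpow_natCast]
  rw [show (m : ℝ) + 2 - s = 2 - s + m by ring, mul_div_assoc]

theorem abs_fOne_sub_le {s : ℝ} (hs : s < 2) {n : ℕ} (hn : 3 * Real.pi / 2 ≤ n) :
    |fOne s - (3 * Real.pi / 2) ^ (2 - s) * ∑ k ∈ Finset.range n, (-1) ^ k *
        (3 * Real.pi / 2) ^ (2 * k + 1) / (2 * k + 1).factorial / (2 * k + 3 - s)| ≤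
      (3 * Real.pi / 2) ^ (2 - s) *
        ((3 * Real.pi / 2) ^ (2 * n) / (2 * n).factorial * 2 / (2 * n + 2 - s)) := by
  have hX : 0 < 3 * Real.pi / 2 := by positivity
  set X := 3 * Real.pi / 2 with hXdef
  have hsum : X ^ (2 - s) * ∑ k ∈ Finset.range n, (-1) ^ k *
        X ^ (2 * k + 1) / (2 * k + 1).factorial / (2 * k + 3 - s) =
      ∫ x in (0 : ℝ)..X, x ^ (1 - s) *
        ∑ k ∈ Finset.range n, (-1) ^ k * x ^ (2 * k + 1) / (2 * k + 1).factorial := by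
    simp_rw [Finset.mul_sum]
    rw [integral_finsetSum fun k _ => intervalIntegrable_rpow_mul_continuous hs (by fun_prop)]
    refine Finset.sum_congr rfl fun k _ => ?_
    have h (x : ℝ) : x ^ (1 - s) * ((-1) ^ k * x ^ (2 * k + 1) / (2 * k + 1).factorial) =
        ((-1) ^ k / (2 * k + 1).factorial) * (x ^ (1 - s) * x ^ (2 * k + 1)) := by ring
    simp_rw [h]
    rw [intervalIntegral.integral_const_mul, integral_rpow_mul_pow hs hX]
    push_cast
    rw [show 2 * (k : ℝ) + 1 + 2 - s = 2 * k + 3 - s by ring]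
    ring
  have herr : X ^ (2 - s) * (X ^ (2 * n) / (2 * n).factorial * 2 / (2 * n + 2 - s)) =
      ∫ x in (0 : ℝ)..X, x ^ (1 - s) * (x ^ (2 * n) / (2 * n).factorial * 2) := by
    have h (x : ℝ) : x ^ (1 - s) * (x ^ (2 * n) / (2 * n).factorial * 2) =
        (2 / (2 * n).factorial) * (x ^ (1 - s) * x ^ (2 * n)) := by ring
    simp_rw [h]
    rw [intervalIntegral.integral_const_mul, integral_rpow_mul_pow hs hX]
    push_cast
    ring
  have hpoly : IntervalIntegrable (fun x : ℝ => x ^ (1 - s) * ∑ k ∈ Finset.range n,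
      (-1) ^ k * x ^ (2 * k + 1) / (2 * k + 1).factorial) volume 0 X :=
    intervalIntegrable_rpow_mul_continuous hs (by fun_prop)
  have hrem : IntervalIntegrable (fun x : ℝ => x ^ (1 - s) *
      (x ^ (2 * n) / (2 * n).factorial * 2)) volume 0 X :=
    intervalIntegrable_rpow_mul_continuous hs (by fun_prop)
  rw [hsum, herr, fOne, ← hXdef, ← integral_sub
    (intervalIntegrable_rpow_mul_continuous hs Real.continuous_sin) hpoly, ← Real.norm_eq_abs]
  refine norm_integral_le_of_norm_le hX.le (Filter.Eventually.of_forall fun x hx => ?_) hrem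
  rw [← mul_sub, norm_mul, Real.norm_of_nonneg (Real.rpow_nonneg hx.1.le _)]
  have h := Real.abs_sin_sub_sum_le (x := x) (n := n) (by rw [abs_of_pos hx.1]; exact hx.2.trans hn)
  rw [abs_of_pos hx.1] at h
  exact mul_le_mul_of_nonneg_left h (Real.rpow_nonneg hx.1.le _)

theorem three_mul_pi_div_two_pow_mem_Icc (m : ℕ) :
    (3 * Real.pi / 2) ^ m ∈
      Set.Icc ((4.71238898038468985769 : ℝ) ^ m) (4.712388980384689857705 ^ m) := by
  have h1 := Real.pi_gt_d20
  have h2 := Real.pi_lt_d20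
  constructor
  · exact pow_le_pow_left₀ (by norm_num) (by linarith) m
  · exact pow_le_pow_left₀ (by positivity) (by linarith) m

theorem fOne_neg_at_left : fOne 0.308443 < 0 := by
  have h := abs_fOne_sub_le (s := 0.308443) (by norm_num) (n := 14)
    (by have := Real.pi_lt_d2; norm_num; linarith)
  have hpos : 0 < (3 * Real.pi / 2) ^ (2 - 0.308443 : ℝ) := by positivity
  have hX := three_mul_pi_div_two_pow_mem_Icc
  generalize 3 * Real.pi / 2 = X at *
  have h2 := (abs_le.1 h).2
  rw [sub_le_iff_le_add, ← mul_add] at h2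
  refine h2.trans_lt (mul_neg_of_pos_of_neg hpos ?_)
  clear h h2 hpos
  simp only [Finset.sum_range_succ, Finset.sum_range_zero, Nat.factorial]
  have := hX 1; have := hX 3; have := hX 5; have := hX 7; have := hX 9; have := hX 11
  have := hX 13; have := hX 15; have := hX 17; have := hX 19; have := hX 21; have := hX 23
  have := hX 25; have := hX 27; have := hX 28
  simp only [Set.mem_Icc] at *
  norm_num at *
  linarith

theorem fOne_pos_at_right : 0 < fOne 0.308444 := by
  have h := abs_fOne_sub_le (s := 0.308444) (by norm_num) (n := 14)
    (by have := Real.pi_lt_d2; norm_num; linarith)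
  have hpos : 0 < (3 * Real.pi / 2) ^ (2 - 0.308444 : ℝ) := by positivity
  have hX := three_mul_pi_div_two_pow_mem_Icc
  generalize 3 * Real.pi / 2 = X at *
  have h2 := (abs_le.1 h).1
  rw [le_sub_iff_add_le, ← sub_eq_neg_add, ← mul_sub] at h2
  refine (mul_pos hpos ?_).trans_le h2
  clear h h2 hpos
  simp only [Finset.sum_range_succ, Finset.sum_range_zero, Nat.factorial]
  have := hX 1; have := hX 3; have := hX 5; have := hX 7; have := hX 9; have := hX 11
  have := hX 13; have := hX 15; have := hX 17; have := hX 19; have := hX 21; have := hX 23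
  have := hX 25; have := hX 27; have := hX 28
  simp only [Set.mem_Icc] at *
  norm_num at *
  linarith

theorem cos_three_mul_pi_div_two : Real.cos (3 * Real.pi / 2) = 0 := by
  rw [show 3 * Real.pi / 2 = Real.pi / 2 + Real.pi by ring, Real.cos_add_pi, Real.cos_pi_div_two,
    neg_zero]

theorem fOne_zero : fOne 0 = -1 := by
  have hcos := cos_three_mul_pi_div_two
  have hsin : Real.sin (3 * Real.pi / 2) = -1 := by
    rw [show 3 * Real.pi / 2 = Real.pi / 2 + Real.pi by ring, Real.sin_add_pi, Real.sin_pi_div_two]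
  have hd (x : ℝ) :
      HasDerivAt (fun x => Real.sin x - x * Real.cos x) (x ^ (1 - 0 : ℝ) * Real.sin x) x := by
    convert! (Real.hasDerivAt_sin x).sub ((hasDerivAt_id x).mul (Real.hasDerivAt_cos x)) using 1
    simp
  rw [fOne, integral_eq_sub_of_hasDerivAt (fun x _ => hd x)
    (intervalIntegrable_rpow_mul_continuous (by norm_num) Real.continuous_sin), hcos, hsin]
  simp

theorem fOne_one : fOne 1 = 1 := by
  have hcos := cos_three_mul_pi_div_two
  simp [fOne, hcos]

theorem hasDerivAt_const_rpow_one_sub {x : ℝ} (hx : 0 < x) (s : ℝ) :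
    HasDerivAt (fun s : ℝ => x ^ (1 - s)) (-(x ^ (1 - s) * Real.log x)) s := by
  convert! ((hasDerivAt_id s).const_sub 1).const_rpow hx using 1
  simp [mul_comm]

theorem hasDerivAt_fOne {s : ℝ} (hs : s ∈ Set.Ioo (-1 : ℝ) 2) :
    IntervalIntegrable (fun x : ℝ => -(x ^ (1 - s) * Real.log x) * Real.sin x) volume 0
      (3 * Real.pi / 2) ∧
    HasDerivAt fOne
      (∫ x in (0 : ℝ)..(3 * Real.pi / 2), -(x ^ (1 - s) * Real.log x) * Real.sin x) s := by
  have hX : 1 ≤ 3 * Real.pi / 2 := by linarith [Real.pi_gt_three]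
  unfold fOne
  set X := 3 * Real.pi / 2
  refine intervalIntegral.hasDerivAt_integral_of_dominated_loc_of_deriv_le
    (F := fun t x => x ^ (1 - t) * Real.sin x)
    (F' := fun t x => -(x ^ (1 - t) * Real.log x) * Real.sin x)
    (bound := fun x => X ^ (3 : ℝ) * |Real.log x|) (isOpen_Ioo.mem_nhds hs)
    (Filter.Eventually.of_forall fun t => ?_)
    (intervalIntegrable_rpow_mul_continuous hs.2 Real.continuous_sin) ?_
    (Filter.Eventually.of_forall fun x hx t ht => ?_)
    (intervalIntegrable_log'.abs.const_mul _)
    (Filter.Eventually.of_forall fun x hx t _ => ?_)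
  · exact Measurable.aestronglyMeasurable (by fun_prop)
  · exact Measurable.aestronglyMeasurable (by fun_prop)
  · rw [Set.uIoc_of_le (by linarith)] at hx
    have hx0 := hx.1
    have hp : 0 ≤ x ^ (1 - t) := Real.rpow_nonneg hx0.le _
    rw [norm_mul, norm_neg, norm_mul, Real.norm_of_nonneg hp, Real.norm_eq_abs, Real.norm_eq_abs]
    calc x ^ (1 - t) * |Real.log x| * |Real.sin x|
        ≤ x ^ (1 - t) * |Real.log x| * |x| :=
          mul_le_mul_of_nonneg_left Real.abs_sin_le_abs (by positivity)
      _ = x ^ (2 - t) * |Real.log x| := by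
          rw [abs_of_pos hx0, show 2 - t = 1 - t + 1 by ring, Real.rpow_add_one hx0.ne']
          ring
      _ ≤ X ^ (3 : ℝ) * |Real.log x| := by
          refine mul_le_mul_of_nonneg_right ?_ (abs_nonneg _)
          exact (Real.rpow_le_rpow hx0.le hx.2 (by linarith [ht.2])).trans
            (Real.rpow_le_rpow_of_exponent_le hX (by linarith [ht.1]))
  · rw [Set.uIoc_of_le (by linarith)] at hx
    exact (hasDerivAt_const_rpow_one_sub hx.1 t).mul_const _

theorem integral_inv_mul_pow_succ {a : ℝ} (ha : 1 ≤ a) (m : ℕ) :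
    ∫ x in (1 : ℝ)..a, x⁻¹ * x ^ (m + 1) = (a ^ (m + 1) - 1) / (m + 1) := by
  have h : ∫ x in (1 : ℝ)..a, x⁻¹ * x ^ (m + 1) = ∫ x in (1 : ℝ)..a, x ^ m := by
    refine integral_congr fun x hx => ?_
    rw [Set.uIcc_of_le ha] at hx
    have : x ≠ 0 := by linarith [hx.1]
    rw [pow_succ', inv_mul_cancel_left₀ this]
  rw [h, integral_pow, one_pow]

theorem intervalIntegrable_inv_mul {a : ℝ} (ha : 1 ≤ a) {g : ℝ → ℝ} (hg : Continuous g) :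
    IntervalIntegrable (fun x : ℝ => x⁻¹ * g x) volume 1 a := by
  refine (ContinuousOn.mul (continuousOn_id.inv₀ fun x hx => ?_)
    hg.continuousOn).intervalIntegrable
  rw [Set.uIcc_of_le ha] at hx
  exact (by linarith [hx.1] : x ≠ 0)

theorem integral_inv_mul_cos_le {a : ℝ} (ha : 1 ≤ a) {n : ℕ} (hn : a ≤ n + 1) :
    ∫ x in (1 : ℝ)..a, x⁻¹ * Real.cos x ≤
      Real.log a + ∑ k ∈ Finset.range n, (-1) ^ (k + 1) / (2 * k + 2).factorial *
        ((a ^ (2 * k + 2) - 1) / (2 * k + 2)) +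
      2 / (2 * n + 2).factorial * ((a ^ (2 * n + 2) - 1) / (2 * n + 2)) := by
  have hlog : ∫ x in (1 : ℝ)..a, x⁻¹ * 1 = Real.log a := by
    simp_rw [mul_one]
    rw [integral_inv_of_pos one_pos (by linarith), div_one]
  have hterm (c : ℝ) (k : ℕ) : c * ((a ^ (2 * k + 2) - 1) / (2 * k + 2)) =
      ∫ x in (1 : ℝ)..a, x⁻¹ * (c * x ^ (2 * k + 2)) := by
    have h (x : ℝ) : x⁻¹ * (c * x ^ (2 * k + 2)) = c * (x⁻¹ * x ^ (2 * k + 1 + 1)) := by ring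
    simp_rw [h]
    rw [intervalIntegral.integral_const_mul, integral_inv_mul_pow_succ ha]
    push_cast
    ring
  simp_rw [← hlog, hterm]
  rw [← integral_finsetSum fun k _ => intervalIntegrable_inv_mul ha (by fun_prop)]
  simp_rw [← Finset.mul_sum]
  rw [← integral_add (intervalIntegrable_inv_mul ha continuous_const)
      (intervalIntegrable_inv_mul ha (by fun_prop))]
  simp_rw [← mul_add]
  rw [← integral_add (intervalIntegrable_inv_mul ha (by fun_prop))
      (intervalIntegrable_inv_mul ha (by fun_prop))]
  refine integral_mono_on ha (intervalIntegrable_inv_mul ha Real.continuous_cos) ?_ fun x hx => ?_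
  · simp_rw [← mul_add]
    exact intervalIntegrable_inv_mul ha (by fun_prop)
  have hx0 : 0 < x := by linarith [hx.1]
  rw [← mul_add]
  refine mul_le_mul_of_nonneg_left ?_ (inv_nonneg.2 hx0.le)
  have h := (abs_le.1 (Real.abs_cos_sub_sum_le (x := x) (n := n + 1) (by
    rw [abs_of_pos hx0]; push_cast; linarith [hx.2]))).2
  rw [Finset.sum_range_succ', abs_of_pos hx0] at h
  have h' : ∑ k ∈ Finset.range n, (-1 : ℝ) ^ (k + 1) / (2 * k + 2).factorial * x ^ (2 * k + 2) =
      ∑ k ∈ Finset.range n, (-1) ^ (k + 1) * x ^ (2 * (k + 1)) / (2 * (k + 1)).factorial :=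
    Finset.sum_congr rfl fun k _ => by rw [show 2 * (k + 1) = 2 * k + 2 by ring]; ring
  rw [h', show 2 * n + 2 = 2 * (n + 1) by ring]
  simp only [mul_zero, pow_zero, Nat.factorial_zero, Nat.cast_one, div_one, mul_one] at h
  have h2 : 2 / ((2 * (n + 1)).factorial : ℝ) * x ^ (2 * (n + 1)) =
      x ^ (2 * (n + 1)) / (2 * (n + 1)).factorial * 2 := by ring
  linarith

theorem integral_inv_mul_cos_le_neg_half :
    ∫ x in (1 : ℝ)..(3 * Real.pi / 2), x⁻¹ * Real.cos x ≤ -(1 / 2) := by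
  have hlog : Real.log (3 * Real.pi / 2) ≤ 1.57 := by
    have h1 : 3 * Real.pi / 2 = 2 ^ 2 * (3 * Real.pi / 8) := by ring
    have h2 := Real.log_le_sub_one_of_pos (x := 3 * Real.pi / 8) (by positivity)
    rw [h1, Real.log_mul (by norm_num) (by positivity), Real.log_pow]
    have h3 := Real.log_two_lt_d9
    have h4 := Real.pi_lt_d4
    norm_num at *
    linarith
  refine (integral_inv_mul_cos_le (by linarith [Real.pi_gt_three]) (n := 7)
    (by have := Real.pi_lt_d2; norm_num; linarith)).trans ?_
  have hX := three_mul_pi_div_two_pow_mem_Icc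
  generalize 3 * Real.pi / 2 = X at *
  simp only [Finset.sum_range_succ, Finset.sum_range_zero, Nat.factorial]
  have := hX 2; have := hX 4; have := hX 6; have := hX 8; have := hX 10; have := hX 12
  have := hX 14; have := hX 16
  simp only [Set.mem_Icc] at *
  norm_num at *
  linarith

theorem half_le_integral_neg_log_mul_sin :
    1 / 2 ≤ ∫ x in (1 : ℝ)..(3 * Real.pi / 2), -(Real.log x * Real.sin x) := by
  have hX : 1 ≤ 3 * Real.pi / 2 := by linarith [Real.pi_gt_three]
  have hcos := cos_three_mul_pi_div_two
  have hi := intervalIntegrable_inv_mul hX Real.continuous_cos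
  have hi' : IntervalIntegrable (fun x => -(Real.log x * Real.sin x)) volume 1
      (3 * Real.pi / 2) :=
    (intervalIntegrable_log'.mul_continuousOn Real.continuous_sin.continuousOn).neg
  have h := integral_eq_sub_of_hasDerivAt (a := 1) (b := 3 * Real.pi / 2)
    (f := fun x => Real.log x * Real.cos x)
    (f' := fun x => x⁻¹ * Real.cos x + -(Real.log x * Real.sin x)) (fun x hx => by
      rw [Set.uIcc_of_le hX] at hx
      convert! (Real.hasDerivAt_log (by linarith [hx.1] : x ≠ 0)).mul (Real.hasDerivAt_cos x)
        using 1
      ring) (hi.add hi')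
  rw [integral_add hi hi', hcos, Real.log_one] at h
  linarith [integral_inv_mul_cos_le_neg_half]

theorem half_le_integral_neg_rpow_mul_log_mul_sin {s : ℝ} (hs : s ∈ Set.Ioo (0 : ℝ) 1) :
    1 / 2 ≤ ∫ x in (0 : ℝ)..(3 * Real.pi / 2), -(x ^ (1 - s) * Real.log x) * Real.sin x := by
  have hpi := Real.pi_gt_three
  have hX : 1 ≤ 3 * Real.pi / 2 := by linarith
  have hint := (hasDerivAt_fOne (s := s) ⟨by linarith [hs.1], by linarith [hs.2]⟩).1
  have h0 := hint.mono_set (c := 0) (d := 1) (by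
    rw [Set.uIcc_of_le zero_le_one, Set.uIcc_of_le (by linarith)]
    exact Set.Icc_subset_Icc_right hX)
  have h1 := hint.mono_set (c := 1) (d := 3 * Real.pi / 2) (by
    rw [Set.uIcc_of_le hX, Set.uIcc_of_le (by linarith)]
    exact Set.Icc_subset_Icc_left zero_le_one)
  rw [← integral_add_adjacent_intervals h0 h1]
  have hleft : 0 ≤ ∫ x in (0 : ℝ)..1, -(x ^ (1 - s) * Real.log x) * Real.sin x := by
    refine integral_nonneg zero_le_one fun x hx => ?_
    refine mul_nonneg ?_ (Real.sin_nonneg_of_nonneg_of_le_pi hx.1 (by linarith [hx.2]))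
    exact neg_nonneg.2 (mul_nonpos_of_nonneg_of_nonpos (Real.rpow_nonneg hx.1 _)
      (Real.log_nonpos hx.1 hx.2))
  have hright : Real.pi ^ (1 - s) *
        ∫ x in (1 : ℝ)..(3 * Real.pi / 2), -(Real.log x * Real.sin x) ≤
      ∫ x in (1 : ℝ)..(3 * Real.pi / 2), -(x ^ (1 - s) * Real.log x) * Real.sin x := by
    rw [← intervalIntegral.integral_const_mul]
    refine integral_mono_on hX ((intervalIntegrable_log'.mul_continuousOn
      Real.continuous_sin.continuousOn).neg.const_mul _) h1 fun x hx => ?_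
    have hlog := Real.log_nonneg hx.1
    suffices 0 ≤ (Real.pi ^ (1 - s) - x ^ (1 - s)) * Real.sin x * Real.log x by linarith
    refine mul_nonneg ?_ hlog
    rcases le_total x Real.pi with h | h
    · exact mul_nonneg (sub_nonneg.2 (Real.rpow_le_rpow (by linarith [hx.1]) h
        (by linarith [hs.2]))) (Real.sin_nonneg_of_nonneg_of_le_pi (by linarith [hx.1]) h)
    · refine mul_nonneg_of_nonpos_of_nonpos (sub_nonpos.2 (Real.rpow_le_rpow (by linarith) h
        (by linarith [hs.2]))) ?_
      rw [← Real.sin_sub_two_pi]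
      exact Real.sin_nonpos_of_nonpos_of_neg_pi_le (by linarith [hx.2]) (by linarith)
  have hone : 1 ≤ Real.pi ^ (1 - s) := Real.one_le_rpow (by linarith) (by linarith [hs.2])
  have hhalf := half_le_integral_neg_log_mul_sin
  nlinarith

theorem strictMonoOn_fOne : StrictMonoOn fOne (Set.Icc 0 1) := by
  refine strictMonoOn_of_deriv_pos (convex_Icc 0 1) (fun s hs => ?_) fun s hs => ?_
  · have h := (hasDerivAt_fOne (s := s) ⟨by linarith [hs.1], by linarith [hs.2]⟩).2
    exact h.continuousAt.continuousWithinAt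
  · rw [interior_Icc] at hs
    rw [(hasDerivAt_fOne ⟨by linarith [hs.1], by linarith [hs.2]⟩).2.deriv]
    linarith [half_le_integral_neg_rpow_mul_log_mul_sin hs]

/-- `f₁(0) = −1`, `f₁(1) = 1`, `f₁` is differentiable on `(0,1)` with
`f₁′(s) ≥ 1/2` there, and there is a unique `s_* ∈ (0.308443, 0.308444)` with `f₁(s_*) = 0`;
moreover `f₁ < 0` on `[0, s_*)` and `f₁ > 0` on `(s_*, 1]`. -/
theorem statement5 :
    fOne 0 = -1 ∧ fOne 1 = 1 ∧
    (∀ s ∈ Set.Ioo (0 : ℝ) 1, DifferentiableAt ℝ fOne s ∧ (1 : ℝ) / 2 ≤ deriv fOne s) ∧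
    ∃ sStar : ℝ, sStar ∈ Set.Ioo (0.308443 : ℝ) 0.308444 ∧ fOne sStar = 0 ∧
      (∀ s ∈ Set.Ioo (0.308443 : ℝ) 0.308444, fOne s = 0 → s = sStar) ∧
      (∀ s : ℝ, 0 ≤ s → s < sStar → fOne s < 0) ∧
      (∀ s : ℝ, sStar < s → s ≤ 1 → 0 < fOne s) := by
  refine ⟨fOne_zero, fOne_one, fun s hs => ?_, ?_⟩
  · have h := (hasDerivAt_fOne (s := s) ⟨by linarith [hs.1], by linarith [hs.2]⟩).2
    exact ⟨h.differentiableAt, h.deriv ▸ half_le_integral_neg_rpow_mul_log_mul_sin hs⟩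
  · have hcont : ContinuousOn fOne (Set.Icc 0.308443 0.308444) := fun s hs =>
      (hasDerivAt_fOne ⟨by linarith [hs.1], by linarith [hs.2]⟩).2.continuousAt.continuousWithinAt
    obtain ⟨t, ht, ht0⟩ := intermediate_value_Ioo (by norm_num) hcont
      (show (0 : ℝ) ∈ Set.Ioo _ _ from ⟨fOne_neg_at_left, fOne_pos_at_right⟩)
    have htI : t ∈ Set.Icc (0 : ℝ) 1 := ⟨by linarith [ht.1], by linarith [ht.2]⟩
    refine ⟨t, ht, ht0, fun s hs hs0 => ?_, fun s h0 h1 => ?_, fun s h0 h1 => ?_⟩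
    · exact strictMonoOn_fOne.injOn ⟨by linarith [hs.1], by linarith [hs.2]⟩ htI (hs0.trans ht0.symm)
    · exact ht0 ▸ strictMonoOn_fOne ⟨h0, by linarith [htI.2]⟩ htI h1
    · exact ht0 ▸ strictMonoOn_fOne htI ⟨by linarith [htI.1], h1⟩ h0

end
end

section
/- There exist absolute constants c₁ > 0 and c₂ > 0 such that for every ν > 0 and every integer N ≥ 1, c₁ · (1 + (πNν)²)^{-1} · log(N+2) ≤ ‖K_{>N}‖_{L¹(𝕋)} ≤ c₂ · (1 + (πNν)²)^{-1} · log(N+2). -/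
open MeasureTheory

noncomputable section

/-- The character `e^{2πit}`. -/
def e1 (t : ℝ) : ℂ := Complex.exp (2 * Real.pi * Complex.I * t)

theorem norm_e1 (t : ℝ) : ‖e1 t‖ = 1 := by
  rw [e1, show (2 * Real.pi * Complex.I * t : ℂ) = ((2 * Real.pi * t : ℝ) : ℂ) * Complex.I by
    push_cast; ring]
  exact Complex.norm_exp_ofReal_mul_I _

theorem e1_add (s t : ℝ) : e1 (s + t) = e1 s * e1 t := by
  rw [e1, e1, e1, ← Complex.exp_add]
  push_cast
  ring_nf

theorem e1_zero : e1 0 = 1 := by simp [e1]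

theorem e1_intCast (k : ℤ) : e1 k = 1 := by
  rw [e1, Complex.exp_eq_one_iff]
  exact ⟨k, by push_cast; ring⟩

theorem e1_natCast_mul (m : ℕ) (x : ℝ) : e1 (m * x) = e1 x ^ m := by
  rw [e1, e1, ← Complex.exp_nat_mul]
  push_cast
  ring_nf

theorem e1_intCast_mul_add_one (k : ℤ) (x : ℝ) : e1 (k * (x + 1)) = e1 (k * x) := by
  rw [mul_add, mul_one, e1_add, e1_intCast, mul_one]

theorem continuous_e1 : Continuous e1 := by
  unfold e1
  fun_prop

theorem four_mul_min_le_norm_one_sub_e1 {x : ℝ} (h0 : 0 ≤ x) (h1 : x ≤ 1) :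
    4 * min x (1 - x) ≤ ‖1 - e1 x‖ := by
  have h : ‖1 - e1 x‖ = 2 * Real.sin (Real.pi * x) := by
    rw [norm_sub_rev, e1, show (2 * Real.pi * Complex.I * x : ℂ)
      = Complex.I * ((2 * Real.pi * x : ℝ) : ℂ) by push_cast; ring,
      Complex.norm_exp_I_mul_ofReal_sub_one, Real.norm_eq_abs,
      show 2 * Real.pi * x / 2 = Real.pi * x by ring, abs_of_nonneg]
    have : 0 ≤ Real.sin (Real.pi * x) :=
      Real.sin_nonneg_of_nonneg_of_le_pi (by positivity) (by nlinarith [Real.pi_pos])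
    positivity
  have key : ∀ y : ℝ, 0 ≤ y → y ≤ 1 / 2 → 2 * y ≤ Real.sin (Real.pi * y) := by
    intro y hy hy'
    have := Real.mul_le_sin (x := Real.pi * y) (by positivity) (by nlinarith [Real.pi_pos])
    calc 2 * y = 2 / Real.pi * (Real.pi * y) := by field_simp
      _ ≤ _ := this
  rw [h]
  rcases le_total x (1 / 2) with hx | hx
  · linarith [key x h0 hx, min_le_left x (1 - x)]
  · have := key (1 - x) (by linarith) (by linarith)
    rw [show Real.pi * (1 - x) = Real.pi - Real.pi * x by ring, Real.sin_pi_sub] at this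
    linarith [min_le_right x (1 - x)]

/-- Abel summation against a nonnegative nonincreasing sequence on the unit circle. -/
theorem norm_sum_mul_pow_mul_norm_one_sub_le {a : ℕ → ℝ} (ha : Antitone a) (h0 : ∀ n, 0 ≤ a n)
    {z : ℂ} (hz : ‖z‖ = 1) (p n : ℕ) :
    ‖∑ j ∈ Finset.range n, (a j : ℂ) * z ^ (p + j)‖ * ‖1 - z‖ ≤ 2 * a 0 := by
  have key : ∀ n, ‖(∑ j ∈ Finset.range n, (a j : ℂ) * z ^ (p + j)) * (1 - z)
      + a n * z ^ (p + n)‖ ≤ 2 * a 0 - a n := by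
    intro n
    induction n with
    | zero => simp [hz, abs_of_nonneg (h0 0)]; linarith
    | succ n ih =>
      have e : (∑ j ∈ Finset.range (n + 1), (a j : ℂ) * z ^ (p + j)) * (1 - z)
          + a (n + 1) * z ^ (p + (n + 1))
          = ((∑ j ∈ Finset.range n, (a j : ℂ) * z ^ (p + j)) * (1 - z) + a n * z ^ (p + n))
            - ((a n - a (n + 1) : ℝ) : ℂ) * z ^ (p + (n + 1)) := by
        rw [Finset.sum_range_succ]
        push_cast
        ring
      rw [e]
      refine (norm_sub_le _ _).trans ?_
      have : ‖((a n - a (n + 1) : ℝ) : ℂ) * z ^ (p + (n + 1))‖ = a n - a (n + 1) := by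
        rw [norm_mul, norm_pow, hz, one_pow, mul_one, Complex.norm_real, Real.norm_eq_abs,
          abs_of_nonneg (sub_nonneg.2 (ha n.le_succ))]
      linarith
  rw [← norm_mul]
  have h1 : ‖(a n : ℂ) * z ^ (p + n)‖ = a n := by
    rw [norm_mul, norm_pow, hz, one_pow, mul_one, Complex.norm_real, Real.norm_eq_abs,
      abs_of_nonneg (h0 n)]
  have h2 := norm_sub_le ((∑ j ∈ Finset.range n, (a j : ℂ) * z ^ (p + j)) * (1 - z)
      + a n * z ^ (p + n)) (a n * z ^ (p + n))
  rw [add_sub_cancel_right] at h2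
  linarith [key n]

theorem norm_pow_sub_one_le {z : ℂ} (hz : ‖z‖ = 1) (n : ℕ) : ‖z ^ n - 1‖ ≤ n * ‖1 - z‖ := by
  induction n with
  | zero => simp
  | succ n ih =>
    have e : z ^ (n + 1) - 1 = (z ^ n - 1) - z ^ n * (1 - z) := by ring
    rw [e]
    refine (norm_sub_le _ _).trans ?_
    rw [norm_mul, norm_pow, hz, one_pow, one_mul]
    push_cast
    linarith

/-- The partial sums of `∑ sin (jθ) / j` are uniformly bounded. -/
theorem norm_sum_pow_sub_pow_div_le {z w : ℂ} (hz : ‖z‖ = 1) (hw : ‖w‖ = 1)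
    (hzw : ‖1 - w‖ = ‖1 - z‖) (h1 : z = 1 → w = 1) (n : ℕ) :
    ‖∑ j ∈ Finset.range n, (((j + 1 : ℝ)⁻¹ : ℝ) : ℂ) * (z ^ (j + 1) - w ^ (j + 1))‖ ≤ 6 := by
  rcases eq_or_ne z 1 with hz1 | hz1
  · simp [hz1, h1 hz1]
  have hδ : 0 < ‖1 - z‖ := norm_pos_iff.2 (sub_ne_zero.2 hz1.symm)
  set δ := ‖1 - z‖ with hδ_def
  have head : ∀ m : ℕ,
      ‖∑ j ∈ Finset.range m, (((j + 1 : ℝ)⁻¹ : ℝ) : ℂ) * (z ^ (j + 1) - w ^ (j + 1))‖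
        ≤ m * (2 * δ) := by
    intro m
    refine (norm_sum_le _ _).trans ?_
    rw [← nsmul_eq_mul]
    conv_rhs => rw [← Finset.card_range m]
    refine Finset.sum_le_card_nsmul _ _ _ fun j _ => ?_
    have hj : (0 : ℝ) < j + 1 := by positivity
    have e : z ^ (j + 1) - w ^ (j + 1) = (z ^ (j + 1) - 1) - (w ^ (j + 1) - 1) := by ring
    have h3 := norm_pow_sub_one_le hz (j + 1)
    have h4 := norm_pow_sub_one_le hw (j + 1)
    rw [hzw] at h4
    have h5 : ‖z ^ (j + 1) - w ^ (j + 1)‖ ≤ (j + 1) * (2 * δ) := by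
      rw [e]
      refine (norm_sub_le _ _).trans ?_
      push_cast at h3 h4
      linarith
    rw [norm_mul, Complex.norm_real, Real.norm_eq_abs, abs_of_pos (inv_pos.2 hj),
      inv_mul_le_iff₀ hj]
    exact h5
  set p := ⌊1 / δ⌋₊ with hp
  have hp1 : (p : ℝ) * δ ≤ 1 := by
    have := Nat.floor_le (a := 1 / δ) (by positivity)
    rwa [← hp, le_div_iff₀ hδ] at this
  have hp2 : 1 ≤ ((p : ℝ) + 1) * δ := by
    have := Nat.lt_floor_add_one (1 / δ)
    rw [← hp, div_lt_iff₀ hδ] at this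
    exact this.le
  rcases le_total n p with hn | hn
  · have : (n : ℝ) ≤ p := by exact_mod_cast hn
    have := head n
    nlinarith
  · obtain ⟨m, rfl⟩ := Nat.exists_eq_add_of_le hn
    rw [Finset.sum_range_add]
    have tail : ∀ u : ℂ, ‖u‖ = 1 → ‖1 - u‖ = δ →
        ‖∑ j ∈ Finset.range m, ((((p + j : ℕ) + 1 : ℝ)⁻¹ : ℝ) : ℂ) * u ^ (p + j + 1)‖ ≤ 2 := by
      intro u hu huδ
      have := norm_sum_mul_pow_mul_norm_one_sub_le (a := fun j => (((p + j : ℕ) + 1 : ℝ))⁻¹)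
        (fun i j hij => by
          dsimp only
          gcongr)
        (fun j => by positivity) hu (p + 1) m
      rw [huδ] at this
      have e : ∀ j, p + 1 + j = p + j + 1 := fun j => by ring
      simp only [e, add_zero] at this
      have h6 : 2 * ((p : ℝ) + 1)⁻¹ ≤ 2 * δ := by
        have : ((p : ℝ) + 1)⁻¹ ≤ δ := by
          rw [inv_le_iff_one_le_mul₀ (by positivity)]
          linarith
        linarith
      exact le_of_mul_le_mul_right (this.trans h6) hδ
    have h7 := head p
    have h8 := tail z hz hδ_def.symm
    have h9 := tail w hw hzw
    refine (norm_add_le _ _).trans ?_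
    have h10 : ‖∑ j ∈ Finset.range m, ((((p + j : ℕ) + 1 : ℝ)⁻¹ : ℝ) : ℂ)
        * (z ^ (p + j + 1) - w ^ (p + j + 1))‖ ≤ 4 := by
      simp only [mul_sub, Finset.sum_sub_distrib]
      refine (norm_sub_le _ _).trans ?_
      linarith
    linarith

theorem integral_Ico_exp_mul {c : ℂ} (hc : c ≠ 0) :
    ∫ x in Set.Ico (0 : ℝ) 1, Complex.exp (c * x) = (Complex.exp c - 1) / c := by
  rw [integral_Ico_eq_integral_Ioc, ← intervalIntegral.integral_of_le zero_le_one,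
    integral_exp_mul_complex hc]
  simp

theorem integral_Ico_e1 (k : ℤ) :
    ∫ x in Set.Ico (0 : ℝ) 1, e1 (k * x) = if k = 0 then 1 else 0 := by
  split_ifs with hk
  · simp [hk, e1_zero]
  · have hc : (2 * Real.pi * Complex.I * k : ℂ) ≠ 0 :=
      mul_ne_zero Complex.two_pi_I_ne_zero (by exact_mod_cast hk)
    have := integral_Ico_exp_mul hc
    have h1 := e1_intCast k
    simp only [e1] at h1 ⊢
    push_cast at h1 ⊢
    rw [h1, sub_self, zero_div] at this
    simpa only [mul_assoc] using this

theorem integrableOn_Ico_of_continuous {f : ℝ → ℂ} (hf : Continuous f) :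
    IntegrableOn f (Set.Ico (0 : ℝ) 1) :=
  hf.integrableOn_Icc.mono_set Set.Ico_subset_Icc_self

/-- The sum `e^{2πimx} + e^{-2πimx}`. -/
def symChar (m : ℕ) (x : ℝ) : ℂ := e1 (m * x) + e1 (-(m * x))

theorem continuous_symChar (m : ℕ) : Continuous (symChar m) := by
  have := continuous_e1
  unfold symChar
  fun_prop

theorem norm_symChar_le (m : ℕ) (x : ℝ) : ‖symChar m x‖ ≤ 2 := by
  refine (norm_add_le _ _).trans ?_
  rw [norm_e1, norm_e1]
  norm_num

theorem symChar_add_one (m : ℕ) (x : ℝ) : symChar m (x + 1) = symChar m x := by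
  have h1 := e1_intCast_mul_add_one m x
  have h2 := e1_intCast_mul_add_one (-m) x
  push_cast [neg_mul] at h1 h2
  rw [symChar, symChar, h1, h2]

theorem integral_symChar_mul_e1 {m : ℕ} (hm : m ≠ 0) (k : ℤ) :
    ∫ x in Set.Ico (0 : ℝ) 1, symChar m x * e1 (-(k : ℝ) * x)
      = if k.natAbs = m then 1 else 0 := by
  have hc := continuous_e1
  have e : ∀ x : ℝ, symChar m x * e1 (-(k : ℝ) * x)
      = e1 (((m - k : ℤ) : ℝ) * x) + e1 (((-m - k : ℤ) : ℝ) * x) := by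
    intro x
    rw [symChar, add_mul, ← e1_add, ← e1_add]
    push_cast
    ring_nf
  simp only [e]
  rw [integral_add (integrableOn_Ico_of_continuous (by fun_prop))
    (integrableOn_Ico_of_continuous (by fun_prop)), integral_Ico_e1, integral_Ico_e1]
  split_ifs <;> first | omega | simp

/-- A function on `[0, 1)` bounded by `B n` and by `B` over the distance to the endpoints has
integral `O (B log n)`. -/
theorem integral_norm_le_mul_log {F : ℝ → ℂ} {B : ℝ} {n : ℕ} (hn : 1 ≤ n)
    (h1 : ∀ x ∈ Set.Ico (0 : ℝ) 1, ‖F x‖ ≤ B * n)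
    (h2 : ∀ x ∈ Set.Ico (0 : ℝ) 1, ‖F x‖ * min x (1 - x) ≤ B) :
    ∫ x in Set.Ico (0 : ℝ) 1, ‖F x‖ ≤ 4 * B * Real.log (n + 2) := by
  have hn' : (0 : ℝ) < n := by exact_mod_cast hn
  have hB : 0 ≤ B := by
    have := (norm_nonneg _).trans (h1 0 (by simp))
    exact nonneg_of_mul_nonneg_left this hn'
  have hε : (0 : ℝ) < (n : ℝ)⁻¹ := inv_pos.2 hn'
  set ε : ℝ := (n : ℝ)⁻¹ with hε_def
  have hnε : n * ε = 1 := mul_inv_cancel₀ hn'.ne'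
  set g : ℝ → ℝ := fun x => 2 * B * ((x + ε)⁻¹ + (1 + ε - x)⁻¹) with hg
  have hpos1 : ∀ x ∈ Set.Icc (0 : ℝ) 1, 0 < x + ε := fun x hx => by linarith [hx.1]
  have hpos2 : ∀ x ∈ Set.Icc (0 : ℝ) 1, 0 < 1 + ε - x := fun x hx => by linarith [hx.2]
  have hc1 : ContinuousOn (fun x : ℝ => (x + ε)⁻¹) (Set.Icc 0 1) :=
    ContinuousOn.inv₀ (by fun_prop) fun x hx => (hpos1 x hx).ne'
  have hc2 : ContinuousOn (fun x : ℝ => (1 + ε - x)⁻¹) (Set.Icc 0 1) :=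
    ContinuousOn.inv₀ (by fun_prop) fun x hx => (hpos2 x hx).ne'
  have hgi : IntegrableOn g (Set.Ico (0 : ℝ) 1) :=
    ((continuousOn_const.mul (hc1.add hc2)).integrableOn_Icc).mono_set Set.Ico_subset_Icc_self
  have hle : ∀ x ∈ Set.Ico (0 : ℝ) 1, ‖F x‖ ≤ g x := by
    intro x hx
    have p1 := hpos1 x ⟨hx.1, hx.2.le⟩
    have p2 := hpos2 x ⟨hx.1, hx.2.le⟩
    have i1 := inv_pos.2 p1
    have i2 := inv_pos.2 p2
    have q1 := h1 x hx
    have q2 := h2 x hx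
    have q3 : ‖F x‖ * ε ≤ B := by
      calc ‖F x‖ * ε ≤ B * n * ε := by gcongr
        _ = B := by rw [mul_assoc, hnε, mul_one]
    have r : ∀ y : ℝ, 0 < y + ε → ‖F x‖ * y ≤ B → ‖F x‖ ≤ 2 * B * (y + ε)⁻¹ := by
      intro y hy h
      rw [← div_eq_mul_inv, le_div_iff₀ hy]
      linarith
    have e : 1 + ε - x = 1 - x + ε := by ring
    simp only [hg, mul_add]
    rcases min_choice x (1 - x) with hm | hm
    · rw [hm] at q2
      have := r x p1 q2
      have : 0 ≤ 2 * B * (1 + ε - x)⁻¹ := by positivity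
      linarith
    · rw [hm] at q2
      have := r (1 - x) (by linarith) q2
      rw [← e] at this
      have : 0 ≤ 2 * B * (x + ε)⁻¹ := by positivity
      linarith
  have hI : ∫ x in Set.Ico (0 : ℝ) 1, g x = 4 * B * Real.log (n + 1) := by
    have hu : Set.uIcc (0 : ℝ) 1 = Set.Icc 0 1 := Set.uIcc_of_le zero_le_one
    have j1 : ∫ x in (0 : ℝ)..1, (x + ε)⁻¹ = Real.log (n + 1) := by
      rw [intervalIntegral.integral_comp_add_right (fun y => y⁻¹),
        integral_inv_of_pos (by linarith) (by linarith)]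
      congr 1
      rw [zero_add, div_eq_iff hε.ne']
      linarith
    have j2 : ∫ x in (0 : ℝ)..1, (1 + ε - x)⁻¹ = Real.log (n + 1) := by
      rw [intervalIntegral.integral_comp_sub_left (fun y => y⁻¹), ← j1,
        intervalIntegral.integral_comp_add_right (fun y => y⁻¹)]
      simp
    rw [integral_Ico_eq_integral_Ioc, ← intervalIntegral.integral_of_le zero_le_one]
    simp only [hg]
    rw [intervalIntegral.integral_const_mul, intervalIntegral.integral_add, j1, j2]
    · ring
    · exact (hu ▸ hc1).intervalIntegrable
    · exact (hu ▸ hc2).intervalIntegrable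
  calc ∫ x in Set.Ico (0 : ℝ) 1, ‖F x‖ ≤ ∫ x in Set.Ico (0 : ℝ) 1, g x := by
        refine integral_mono_of_nonneg (Filter.Eventually.of_forall fun x => norm_nonneg _) hgi ?_
        exact (ae_restrict_mem measurableSet_Ico).mono hle
    _ = 4 * B * Real.log (n + 1) := hI
    _ ≤ 4 * B * Real.log (n + 2) := by
        gcongr
        norm_num

theorem integrableOn_mul_e1 {K : ℝ → ℂ} (hK : IntegrableOn K (Set.Ico (0 : ℝ) 1)) (t : ℝ) :
    IntegrableOn (fun x => K x * e1 (t * x)) (Set.Ico (0 : ℝ) 1) := by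
  have hc := continuous_e1
  refine Integrable.mul_bdd (c := 1) hK
    (Continuous.aestronglyMeasurable (by fun_prop)) ?_
  exact Filter.Eventually.of_forall fun x => (norm_e1 _).le

/-- Lower bound for the `L¹` norm of a function with a spectral gap, by testing against
`sin (2πNx) ∑ sin (2πjx) / j`. -/
theorem le_integral_norm_of_spectral_gap {K : ℝ → ℂ} {b : ℝ} {N : ℕ} (hb : 0 < b) (hN : 1 ≤ N)
    (hK : IntegrableOn K (Set.Ico (0 : ℝ) 1))
    (h1 : ∀ k : ℤ, (N : ℤ) < |k| →
      (∫ x in Set.Ico (0 : ℝ) 1, K x * e1 (-(k : ℝ) * x)) = (((1 + b * (k : ℝ) ^ 2)⁻¹ : ℝ) : ℂ))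
    (h2 : ∀ k : ℤ, |k| ≤ (N : ℤ) → (∫ x in Set.Ico (0 : ℝ) 1, K x * e1 (-(k : ℝ) * x)) = 0) :
    (1 + b * (2 * N) ^ 2)⁻¹ * Real.log (N + 2) ≤ 12 * ∫ x in Set.Ico (0 : ℝ) 1, ‖K x‖ := by
  set w : ℝ → ℂ := fun x => (e1 (N * x) - e1 (-(N * x))) * ∑ j ∈ Finset.range N,
    (((j + 1 : ℝ)⁻¹ : ℝ) : ℂ) * (e1 x ^ (j + 1) - e1 (-x) ^ (j + 1)) with hw
  have hwb : ∀ x, ‖w x‖ ≤ 12 := by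
    intro x
    have i1 : ‖e1 (N * x) - e1 (-(N * x))‖ ≤ 2 := by
      refine (norm_sub_le _ _).trans ?_
      rw [norm_e1, norm_e1]
      norm_num
    have hinv : e1 x * e1 (-x) = 1 := by rw [← e1_add, add_neg_cancel, e1_zero]
    have i2 := norm_sum_pow_sub_pow_div_le (norm_e1 x) (norm_e1 (-x))
      (by
        have : 1 - e1 (-x) = -(e1 (-x) * (1 - e1 x)) := by linear_combination -hinv
        rw [this, norm_neg, norm_mul, norm_e1, one_mul])
      (fun h => by rwa [h, one_mul] at hinv) N
    rw [hw]
    dsimp only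
    rw [norm_mul]
    calc _ ≤ 2 * (6 : ℝ) := mul_le_mul i1 i2 (norm_nonneg _) zero_le_two
      _ = 12 := by norm_num
  have hI : ∫ x in Set.Ico (0 : ℝ) 1, K x * w x
      = ((∑ j ∈ Finset.range N, (j + 1 : ℝ)⁻¹ * (2 * (1 + b * (N + (j + 1)) ^ 2)⁻¹) : ℝ) : ℂ) := by
    have e : ∀ x, K x * w x = ∑ j ∈ Finset.range N, (((j + 1 : ℝ)⁻¹ : ℝ) : ℂ) *
        (K x * e1 (-((-(N + (j + 1)) : ℤ) : ℝ) * x) - K x * e1 (-((-(N - (j + 1)) : ℤ) : ℝ) * x)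
          - (K x * e1 (-((N - (j + 1) : ℤ) : ℝ) * x)
            - K x * e1 (-((N + (j + 1) : ℤ) : ℝ) * x))) := by
      intro x
      rw [hw]
      dsimp only
      rw [Finset.mul_sum, Finset.mul_sum]
      refine Finset.sum_congr rfl fun j _ => ?_
      rw [← e1_natCast_mul, ← e1_natCast_mul]
      have p1 : e1 (-((-(N + (j + 1)) : ℤ) : ℝ) * x)
          = e1 (N * x) * e1 ((j + 1 : ℕ) * x) := by
        rw [← e1_add]; push_cast; ring_nf
      have p2 : e1 (-((-(N - (j + 1)) : ℤ) : ℝ) * x)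
          = e1 (N * x) * e1 ((j + 1 : ℕ) * -x) := by
        rw [← e1_add]; push_cast; ring_nf
      have p3 : e1 (-((N - (j + 1) : ℤ) : ℝ) * x)
          = e1 (-(N * x)) * e1 ((j + 1 : ℕ) * x) := by
        rw [← e1_add]; push_cast; ring_nf
      have p4 : e1 (-((N + (j + 1) : ℤ) : ℝ) * x)
          = e1 (-(N * x)) * e1 ((j + 1 : ℕ) * -x) := by
        rw [← e1_add]; push_cast; ring_nf
      rw [p1, p2, p3, p4]
      ring
    have hi : ∀ k : ℤ, Integrable (fun x => K x * e1 (-(k : ℝ) * x))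
        (volume.restrict (Set.Ico (0 : ℝ) 1)) := fun k => integrableOn_mul_e1 hK _
    have hi2 : ∀ k l : ℤ, Integrable (fun x =>
        K x * e1 (-(k : ℝ) * x) - K x * e1 (-(l : ℝ) * x))
        (volume.restrict (Set.Ico (0 : ℝ) 1)) := fun k l => (hi k).sub (hi l)
    have hi4 : ∀ k₁ k₂ k₃ k₄ : ℤ, Integrable (fun x =>
        K x * e1 (-(k₁ : ℝ) * x) - K x * e1 (-(k₂ : ℝ) * x)
          - (K x * e1 (-(k₃ : ℝ) * x) - K x * e1 (-(k₄ : ℝ) * x)))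
        (volume.restrict (Set.Ico (0 : ℝ) 1)) :=
      fun _ _ _ _ => (hi2 _ _).sub (hi2 _ _)
    have hI4 : ∀ k₁ k₂ k₃ k₄ : ℤ, ∫ x in Set.Ico (0 : ℝ) 1,
        (K x * e1 (-(k₁ : ℝ) * x) - K x * e1 (-(k₂ : ℝ) * x)
          - (K x * e1 (-(k₃ : ℝ) * x) - K x * e1 (-(k₄ : ℝ) * x)))
        = (∫ x in Set.Ico (0 : ℝ) 1, K x * e1 (-(k₁ : ℝ) * x))
          - (∫ x in Set.Ico (0 : ℝ) 1, K x * e1 (-(k₂ : ℝ) * x))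
          - ((∫ x in Set.Ico (0 : ℝ) 1, K x * e1 (-(k₃ : ℝ) * x))
            - ∫ x in Set.Ico (0 : ℝ) 1, K x * e1 (-(k₄ : ℝ) * x)) := by
      intro k₁ k₂ k₃ k₄
      rw [integral_sub (hi2 _ _) (hi2 _ _), integral_sub (hi _) (hi _),
        integral_sub (hi _) (hi _)]
    simp only [e]
    rw [integral_finsetSum _ fun j _ => (hi4 _ _ _ _).const_mul _]
    rw [Complex.ofReal_sum]
    refine Finset.sum_congr rfl fun j hj => ?_
    have hj' := Finset.mem_range.1 hj
    rw [integral_const_mul, hI4, h1 (-(N + (j + 1))) (by rw [abs_neg, abs_of_nonneg] <;> omega),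
      h1 (N + (j + 1)) (by rw [abs_of_nonneg] <;> omega),
      h2 (-(N - (j + 1))) (by rw [abs_neg, abs_of_nonneg] <;> omega),
      h2 (N - (j + 1)) (by rw [abs_of_nonneg] <;> omega)]
    push_cast
    ring
  have hsum : (1 + b * (2 * N) ^ 2)⁻¹ * Real.log (N + 2)
      ≤ ∑ j ∈ Finset.range N, (j + 1 : ℝ)⁻¹ * (2 * (1 + b * (N + (j + 1)) ^ 2)⁻¹) := by
    have hlog : Real.log (N + 2) ≤ 2 * ∑ j ∈ Finset.range N, (j + 1 : ℝ)⁻¹ := by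
      have hh := log_add_one_le_harmonic N
      have hN' : (1 : ℝ) ≤ N := by exact_mod_cast hN
      have : Real.log (N + 2) ≤ 2 * Real.log (N + 1) := by
        rw [← Real.log_rpow (by linarith)]
        refine Real.log_le_log (by linarith) ?_
        norm_num
        nlinarith
      rw [harmonic] at hh
      push_cast at hh
      linarith
    calc _ ≤ (1 + b * (2 * N) ^ 2)⁻¹ * (2 * ∑ j ∈ Finset.range N, (j + 1 : ℝ)⁻¹) := by gcongr
      _ = ∑ j ∈ Finset.range N, (j + 1 : ℝ)⁻¹ * (2 * (1 + b * (2 * N) ^ 2)⁻¹) := by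
        rw [← Finset.sum_mul]; ring
      _ ≤ _ := by
        refine Finset.sum_le_sum fun j hj => ?_
        have : (j + 1 : ℝ) ≤ N := by exact_mod_cast Finset.mem_range.1 hj
        gcongr
        linarith
  calc _ ≤ ‖∫ x in Set.Ico (0 : ℝ) 1, K x * w x‖ := by
        rw [hI, Complex.norm_real]
        exact hsum.trans (Real.le_norm_self _)
    _ ≤ ∫ x in Set.Ico (0 : ℝ) 1, 12 * ‖K x‖ := by
        refine norm_integral_le_of_norm_le (hK.norm.const_mul 12)
          (Filter.Eventually.of_forall fun x => ?_)
        rw [norm_mul, mul_comm]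
        exact mul_le_mul_of_nonneg_right (hwb x) (norm_nonneg _)
    _ = _ := integral_const_mul _ _

/-- The multiplier `1 / (1 + b m²)`. -/
def resolventCoeff (b : ℝ) (m : ℕ) : ℝ := (1 + b * (m : ℝ) ^ 2)⁻¹

theorem resolventCoeff_pos {b : ℝ} (hb : 0 < b) (m : ℕ) : 0 < resolventCoeff b m := by
  unfold resolventCoeff
  positivity

theorem resolventCoeff_antitone {b : ℝ} (hb : 0 < b) : Antitone (resolventCoeff b) := by
  intro m n h
  unfold resolventCoeff
  gcongr

theorem resolventCoeff_natAbs (b : ℝ) (k : ℤ) :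
    resolventCoeff b k.natAbs = (1 + b * (k : ℝ) ^ 2)⁻¹ := by
  rw [resolventCoeff, Nat.cast_natAbs, Int.cast_abs, sq_abs]

theorem norm_sum_resolventCoeff_symChar_mul_min_le {b : ℝ} (hb : 0 < b) (p n : ℕ) {x : ℝ}
    (hx : x ∈ Set.Ico (0 : ℝ) 1) :
    ‖∑ j ∈ Finset.range n, (resolventCoeff b (p + j) : ℂ) * symChar (p + j) x‖ * min x (1 - x)
      ≤ resolventCoeff b p := by
  have h := four_mul_min_le_norm_one_sub_e1 hx.1 hx.2.le
  have hinv : e1 x * e1 (-x) = 1 := by rw [← e1_add, add_neg_cancel, e1_zero]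
  have hneg : ‖1 - e1 (-x)‖ = ‖1 - e1 x‖ := by
    have : 1 - e1 (-x) = -(e1 (-x) * (1 - e1 x)) := by linear_combination -hinv
    rw [this, norm_neg, norm_mul, norm_e1, one_mul]
  have ha : Antitone fun j => resolventCoeff b (p + j) :=
    fun i j hij => resolventCoeff_antitone hb (by omega)
  have h0 : ∀ j, 0 ≤ resolventCoeff b (p + j) := fun j => (resolventCoeff_pos hb _).le
  have A1 := norm_sum_mul_pow_mul_norm_one_sub_le ha h0 (norm_e1 x) p n
  have A2 := norm_sum_mul_pow_mul_norm_one_sub_le ha h0 (norm_e1 (-x)) p n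
  rw [hneg] at A2
  rw [add_zero] at A1 A2
  have e : ∑ j ∈ Finset.range n, (resolventCoeff b (p + j) : ℂ) * symChar (p + j) x
      = (∑ j ∈ Finset.range n, (resolventCoeff b (p + j) : ℂ) * e1 x ^ (p + j))
        + ∑ j ∈ Finset.range n, (resolventCoeff b (p + j) : ℂ) * e1 (-x) ^ (p + j) := by
    rw [← Finset.sum_add_distrib]
    refine Finset.sum_congr rfl fun j _ => ?_
    rw [symChar, ← mul_neg, e1_natCast_mul, e1_natCast_mul, mul_add]
  have hm : 0 ≤ min x (1 - x) := le_min hx.1 (by linarith [hx.2])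
  rw [e]
  have T := norm_add_le
    (∑ j ∈ Finset.range n, (resolventCoeff b (p + j) : ℂ) * e1 x ^ (p + j))
    (∑ j ∈ Finset.range n, (resolventCoeff b (p + j) : ℂ) * e1 (-x) ^ (p + j))
  have T1 := mul_le_mul_of_nonneg_right T hm
  have T2 := mul_le_mul_of_nonneg_left h
    (norm_nonneg (∑ j ∈ Finset.range n, (resolventCoeff b (p + j) : ℂ) * e1 x ^ (p + j)))
  have T3 := mul_le_mul_of_nonneg_left h
    (norm_nonneg (∑ j ∈ Finset.range n, (resolventCoeff b (p + j) : ℂ) * e1 (-x) ^ (p + j)))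
  linarith

theorem sum_resolventCoeff_le {b : ℝ} (hb : 0 < b) {N : ℕ} (hN : 1 ≤ N) (n : ℕ) :
    ∑ j ∈ Finset.range n, resolventCoeff b (N + 1 + j) ≤ (b * N)⁻¹ := by
  have hN' : (0 : ℝ) < N := by exact_mod_cast hN
  have key : ∑ j ∈ Finset.range n, resolventCoeff b (N + 1 + j)
      ≤ (b * N)⁻¹ - (b * (N + n))⁻¹ := by
    induction n with
    | zero => simp
    | succ n ih =>
      rw [Finset.sum_range_succ]
      have : resolventCoeff b (N + 1 + n) ≤ (b * (N + n))⁻¹ - (b * (N + (n + 1)))⁻¹ := by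
        have hy : (0 : ℝ) < N + n := by positivity
        rw [resolventCoeff]
        push_cast
        generalize hyd : (N : ℝ) + n = y at hy
        rw [show (N : ℝ) + 1 + n = y + 1 by linarith, show (N : ℝ) + (n + 1) = y + 1 by linarith]
        have : (b * y)⁻¹ - (b * (y + 1))⁻¹ = (b * (y * (y + 1)))⁻¹ := by
          field_simp
          ring
        rw [this]
        refine inv_anti₀ (by positivity) ?_
        nlinarith
      push_cast
      linarith
  have : 0 ≤ (b * (N + n : ℝ))⁻¹ := by positivity
  linarith

theorem summable_resolventCoeff {b : ℝ} (hb : 0 < b) {N : ℕ} (hN : 1 ≤ N) :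
    Summable fun j => resolventCoeff b (N + 1 + j) :=
  summable_of_sum_range_le (fun _ => (resolventCoeff_pos hb _).le) (sum_resolventCoeff_le hb hN)

theorem tsum_resolventCoeff_le {b : ℝ} (hb : 0 < b) {N : ℕ} (hN : 1 ≤ N) :
    ∑' j, resolventCoeff b (N + 1 + j) ≤ (b * N)⁻¹ :=
  Real.tsum_le_of_sum_range_le (fun _ => (resolventCoeff_pos hb _).le) (sum_resolventCoeff_le hb hN)

/-- The kernel as a Fourier series, well suited to large `b N²`. -/
def tailKernel (b : ℝ) (N : ℕ) (x : ℝ) : ℂ :=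
  ∑' j : ℕ, (resolventCoeff b (N + 1 + j) : ℂ) * symChar (N + 1 + j) x

theorem norm_resolventCoeff_mul_symChar_le {b : ℝ} (hb : 0 < b) (m : ℕ) (x : ℝ) :
    ‖(resolventCoeff b m : ℂ) * symChar m x‖ ≤ 2 * resolventCoeff b m := by
  have h := (resolventCoeff_pos hb m).le
  rw [norm_mul, Complex.norm_real, Real.norm_eq_abs, abs_of_nonneg h, mul_comm]
  exact mul_le_mul_of_nonneg_right (norm_symChar_le m x) h

theorem summable_tailKernel {b : ℝ} (hb : 0 < b) {N : ℕ} (hN : 1 ≤ N) (x : ℝ) :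
    Summable fun j => (resolventCoeff b (N + 1 + j) : ℂ) * symChar (N + 1 + j) x :=
  Summable.of_norm_bounded ((summable_resolventCoeff hb hN).mul_left 2)
    fun _ => norm_resolventCoeff_mul_symChar_le hb _ x

theorem continuous_tailKernel {b : ℝ} (hb : 0 < b) {N : ℕ} (hN : 1 ≤ N) :
    Continuous (tailKernel b N) :=
  continuous_tsum (fun _ => continuous_const.mul (continuous_symChar _))
    ((summable_resolventCoeff hb hN).mul_left 2)
    fun _ x => norm_resolventCoeff_mul_symChar_le hb _ x

theorem tailKernel_add_one (b : ℝ) (N : ℕ) (x : ℝ) :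
    tailKernel b N (x + 1) = tailKernel b N x := by
  simp only [tailKernel, symChar_add_one]

theorem integral_resolventCoeff_mul_symChar_mul_e1 (b : ℝ) {m : ℕ} (hm : m ≠ 0) (k : ℤ) :
    ∫ x in Set.Ico (0 : ℝ) 1, (resolventCoeff b m : ℂ) * symChar m x * e1 (-(k : ℝ) * x)
      = if k.natAbs = m then (((1 + b * (k : ℝ) ^ 2)⁻¹ : ℝ) : ℂ) else 0 := by
  simp only [mul_assoc]
  rw [integral_const_mul, integral_symChar_mul_e1 hm]
  split_ifs with h
  · rw [mul_one, ← h, resolventCoeff_natAbs]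
  · rw [mul_zero]

theorem integral_tailKernel_mul_e1 {b : ℝ} (hb : 0 < b) {N : ℕ} (hN : 1 ≤ N) (k : ℤ) :
    ∫ x in Set.Ico (0 : ℝ) 1, tailKernel b N x * e1 (-(k : ℝ) * x)
      = if N < k.natAbs then (((1 + b * (k : ℝ) ^ 2)⁻¹ : ℝ) : ℂ) else 0 := by
  have hc := continuous_e1
  have hcs := continuous_symChar
  have H := hasSum_integral_of_summable_integral_norm (μ := volume.restrict (Set.Ico (0 : ℝ) 1))
    (F := fun (j : ℕ) x => (resolventCoeff b (N + 1 + j) : ℂ) * symChar (N + 1 + j) x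
      * e1 (-(k : ℝ) * x))
    (fun j => integrableOn_Ico_of_continuous
      ((continuous_const.mul (hcs _)).mul (by fun_prop)))
    (by
      refine Summable.of_nonneg_of_le (fun j => integral_nonneg fun x => norm_nonneg _)
        (fun j => ?_) ((summable_resolventCoeff hb hN).mul_left 2)
      calc _ ≤ ∫ x in Set.Ico (0 : ℝ) 1, 2 * resolventCoeff b (N + 1 + j) := by
            refine integral_mono_of_nonneg (Filter.Eventually.of_forall fun x => norm_nonneg _)
              (integrable_const _) (Filter.Eventually.of_forall fun x => ?_)
            dsimp only
            rw [norm_mul, norm_e1, mul_one]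
            exact norm_resolventCoeff_mul_symChar_le hb _ x
        _ = _ := by simp)
  have e : ∀ x, tailKernel b N x * e1 (-(k : ℝ) * x)
      = ∑' j : ℕ, (resolventCoeff b (N + 1 + j) : ℂ) * symChar (N + 1 + j) x
        * e1 (-(k : ℝ) * x) := fun x => tsum_mul_right.symm
  simp only [e]
  rw [← H.tsum_eq]
  have t : ∀ j : ℕ, N + 1 + j ≠ 0 := fun j => by omega
  simp only [integral_resolventCoeff_mul_symChar_mul_e1 b (t _)]
  split_ifs with h
  · rw [tsum_eq_single (k.natAbs - (N + 1)) fun j hj => if_neg (by omega), if_pos (by omega)]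
  · rw [tsum_congr fun j => if_neg (by omega), tsum_zero]

theorem integral_norm_tailKernel_le {b : ℝ} (hb : 0 < b) {N : ℕ} (hN : 1 ≤ N) :
    ∫ x in Set.Ico (0 : ℝ) 1, ‖tailKernel b N x‖
      ≤ 4 * (2 * (b * N ^ 2)⁻¹) * Real.log (N + 2) := by
  have hN' : (0 : ℝ) < N := by exact_mod_cast hN
  refine integral_norm_le_mul_log hN (fun x _ => ?_) fun x hx => ?_
  · have hs := (summable_resolventCoeff hb hN).mul_left 2
    calc ‖tailKernel b N x‖ ≤ ∑' j, 2 * resolventCoeff b (N + 1 + j) :=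
          tsum_of_norm_bounded hs.hasSum fun j => norm_resolventCoeff_mul_symChar_le hb _ x
      _ ≤ 2 * (b * N)⁻¹ := by
          rw [tsum_mul_left]
          exact mul_le_mul_of_nonneg_left (tsum_resolventCoeff_le hb hN) zero_le_two
      _ = 2 * (b * N ^ 2)⁻¹ * N := by field_simp
  · have h1 : ‖tailKernel b N x‖ * min x (1 - x) ≤ resolventCoeff b (N + 1) :=
      le_of_tendsto' ((summable_tailKernel hb hN x).hasSum.tendsto_sum_nat.norm.mul_const _)
        fun n => norm_sum_resolventCoeff_symChar_mul_min_le hb (N + 1) n hx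
    have h2 : resolventCoeff b (N + 1) ≤ (b * N ^ 2)⁻¹ := by
      rw [resolventCoeff]
      refine inv_anti₀ (by positivity) ?_
      push_cast
      nlinarith
    have h3 : 0 ≤ (b * (N : ℝ) ^ 2)⁻¹ := by positivity
    linarith

/-- The periodization of `(2ν)⁻¹ exp (-|x|/ν)`, restricted to `[0, 1)`, with `s = 1/ν`. -/
def resolventKernel (s x : ℝ) : ℝ :=
  s / 2 * (Real.exp (-s * x) / (1 - Real.exp (-s)) + Real.exp (s * x) / (Real.exp s - 1))

theorem continuous_resolventKernel (s : ℝ) : Continuous (resolventKernel s) := by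
  unfold resolventKernel
  fun_prop

theorem resolventKernel_nonneg {s : ℝ} (hs : 0 < s) (x : ℝ) : 0 ≤ resolventKernel s x := by
  have h1 : 0 < 1 - Real.exp (-s) := by simpa using hs
  have h2 : 0 < Real.exp s - 1 := by simpa using hs
  unfold resolventKernel
  positivity

theorem integral_resolventKernel_mul_e1 {s : ℝ} (hs : 0 < s) (k : ℤ) :
    ∫ x in Set.Ico (0 : ℝ) 1, (resolventKernel s x : ℂ) * e1 (-(k : ℝ) * x)
      = (((1 + (2 * Real.pi * k / s) ^ 2)⁻¹ : ℝ) : ℂ) := by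
  have h1 : 0 < 1 - Real.exp (-s) := by simpa using hs
  have h2 : 0 < Real.exp s - 1 := by simpa using hs
  have h1' : (1 - Complex.exp (-s) : ℂ) ≠ 0 := by exact_mod_cast h1.ne'
  have h2' : (Complex.exp s - 1 : ℂ) ≠ 0 := by exact_mod_cast h2.ne'
  set ω : ℂ := 2 * Real.pi * Complex.I * k with hω
  have hωe : Complex.exp (-ω) = 1 := by
    have := e1_intCast (-k)
    rw [e1] at this
    rw [← this, hω]
    push_cast
    ring_nf
  have hωre : ω.re = 0 := by simp [hω]
  have c1 : -(s : ℂ) - ω ≠ 0 := fun h => by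
    have := congrArg Complex.re h
    simp [hωre] at this
    exact hs.ne' this
  have c2 : (s : ℂ) - ω ≠ 0 := fun h => by
    have := congrArg Complex.re h
    simp [hωre] at this
    exact hs.ne' this
  have e : ∀ x : ℝ, (resolventKernel s x : ℂ) * e1 (-(k : ℝ) * x)
      = s / 2 * (1 - Complex.exp (-s))⁻¹ * Complex.exp ((-s - ω) * x)
        + s / 2 * (Complex.exp s - 1)⁻¹ * Complex.exp ((s - ω) * x) := by
    intro x
    have p : e1 (-(k : ℝ) * x) = Complex.exp (-ω * x) := by
      rw [e1, hω]; push_cast; ring_nf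
    have q : ∀ u : ℂ, Complex.exp ((u - ω) * x) = Complex.exp (u * x) * Complex.exp (-ω * x) :=
      fun u => by rw [← Complex.exp_add]; ring_nf
    rw [p, resolventKernel, q, q]
    push_cast
    ring
  simp only [e]
  rw [integral_add (integrableOn_Ico_of_continuous (by fun_prop))
    (integrableOn_Ico_of_continuous (by fun_prop)), integral_const_mul, integral_const_mul,
    integral_Ico_exp_mul c1, integral_Ico_exp_mul c2, sub_eq_add_neg (-(s : ℂ)), Complex.exp_add,
    sub_eq_add_neg (s : ℂ), Complex.exp_add, hωe, mul_one, mul_one, ← sub_eq_add_neg,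
    ← sub_eq_add_neg]
  have t1 : (1 - Complex.exp (-s))⁻¹ * ((Complex.exp (-s) - 1) / (-s - ω)) = (s + ω)⁻¹ := by
    have c3 : (s : ℂ) + ω ≠ 0 := fun h => c1 (by linear_combination -h)
    rw [show -(s : ℂ) - ω = -(s + ω) by ring]
    field_simp
    ring
  have t2 : (Complex.exp s - 1)⁻¹ * ((Complex.exp s - 1) / (s - ω)) = (s - ω)⁻¹ := by
    field_simp
  rw [mul_assoc, t1, mul_assoc, t2]
  have c3 : (s : ℂ) + ω ≠ 0 := fun h => c1 (by linear_combination -h)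
  have hs' : (s : ℂ) ≠ 0 := by exact_mod_cast hs.ne'
  have hq : (1 : ℂ) + (2 * Real.pi * k / s) ^ 2 = (s + ω) * (s - ω) / s ^ 2 := by
    rw [hω]
    field_simp
    linear_combination (4 * (Real.pi : ℂ) ^ 2 * k ^ 2) * Complex.I_sq
  push_cast
  rw [hq]
  field_simp
  ring

/-- The truncated Fourier series of the resolvent kernel. -/
def truncatedKernel (b : ℝ) (N : ℕ) (x : ℝ) : ℂ :=
  1 + ∑ j ∈ Finset.range N, (resolventCoeff b (1 + j) : ℂ) * symChar (1 + j) x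

theorem continuous_truncatedKernel (b : ℝ) (N : ℕ) : Continuous (truncatedKernel b N) := by
  have := continuous_symChar
  unfold truncatedKernel
  fun_prop

theorem truncatedKernel_add_one (b : ℝ) (N : ℕ) (x : ℝ) :
    truncatedKernel b N (x + 1) = truncatedKernel b N x := by
  simp only [truncatedKernel, symChar_add_one]

theorem integral_truncatedKernel_mul_e1 (b : ℝ) (N : ℕ) (k : ℤ) :
    ∫ x in Set.Ico (0 : ℝ) 1, truncatedKernel b N x * e1 (-(k : ℝ) * x)
      = if N < k.natAbs then 0 else (((1 + b * (k : ℝ) ^ 2)⁻¹ : ℝ) : ℂ) := by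
  have hc := continuous_e1
  have hcs := continuous_symChar
  simp only [truncatedKernel, add_mul, Finset.sum_mul, one_mul]
  rw [integral_add (integrableOn_Ico_of_continuous (by fun_prop))
    (integrableOn_Ico_of_continuous (by fun_prop)),
    integral_finsetSum _ fun j _ => integrableOn_Ico_of_continuous (by fun_prop)]
  have t : ∀ j : ℕ, 1 + j ≠ 0 := fun j => by omega
  simp only [integral_resolventCoeff_mul_symChar_mul_e1 b (t _)]
  have h0 := integral_Ico_e1 (-k)
  push_cast at h0
  rw [h0]
  rcases eq_or_ne k 0 with rfl | hk
  · simp only [neg_zero, if_true, Int.natAbs_zero, not_lt_zero, if_false]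
    rw [Finset.sum_eq_zero fun j _ => if_neg (by omega)]
    simp
  · rw [if_neg (by simpa using hk), zero_add]
    split_ifs with h
    · exact Finset.sum_eq_zero fun j hj => if_neg (by have := Finset.mem_range.1 hj; omega)
    · rw [Finset.sum_eq_single (k.natAbs - 1) (fun j _ hj => if_neg (by omega))
        (fun hj => absurd (Finset.mem_range.2 (by omega)) hj), if_pos (by omega)]

theorem integral_norm_truncatedKernel_le {b : ℝ} (hb : 0 < b) {N : ℕ} (hN : 1 ≤ N) :
    ∫ x in Set.Ico (0 : ℝ) 1, ‖truncatedKernel b N x‖ ≤ 4 * 3 * Real.log (N + 2) := by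
  have hN' : (1 : ℝ) ≤ N := by exact_mod_cast hN
  have hone : ∀ m, resolventCoeff b m ≤ 1 := fun m => by
    rw [resolventCoeff]
    exact inv_le_one_of_one_le₀ (by nlinarith [sq_nonneg (m : ℝ)])
  refine integral_norm_le_mul_log hN (fun x _ => ?_) fun x hx => ?_
  · rw [truncatedKernel]
    refine (norm_add_le _ _).trans ?_
    have : ‖∑ j ∈ Finset.range N, (resolventCoeff b (1 + j) : ℂ) * symChar (1 + j) x‖
        ≤ (Finset.range N).card • (2 : ℝ) := by
      refine (norm_sum_le _ _).trans (Finset.sum_le_card_nsmul _ _ _ fun j _ => ?_)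
      linarith [norm_resolventCoeff_mul_symChar_le hb (1 + j) x, hone (1 + j)]
    rw [Finset.card_range, nsmul_eq_mul] at this
    rw [norm_one]
    linarith
  · have h := norm_sum_resolventCoeff_symChar_mul_min_le hb 1 N hx
    have hm : 0 ≤ min x (1 - x) := le_min hx.1 (by linarith [hx.2])
    have hm' : min x (1 - x) ≤ 1 := (min_le_left _ _).trans hx.2.le
    have ht := mul_le_mul_of_nonneg_right (norm_add_le (1 : ℂ)
      (∑ j ∈ Finset.range N, (resolventCoeff b (1 + j) : ℂ) * symChar (1 + j) x)) hm
    rw [norm_one] at ht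
    rw [truncatedKernel]
    linarith [hone 1]

/-- The kernel as the full resolvent kernel minus its truncated Fourier series, well suited to
small `b N²`. -/
def differenceKernel (s b : ℝ) (N : ℕ) (x : ℝ) : ℂ :=
  (resolventKernel s (Int.fract x) : ℂ) - truncatedKernel b N x

theorem differenceKernel_add_one (s b : ℝ) (N : ℕ) (x : ℝ) :
    differenceKernel s b N (x + 1) = differenceKernel s b N x := by
  rw [differenceKernel, differenceKernel, Int.fract_add_one, truncatedKernel_add_one]

theorem differenceKernel_eq {s b : ℝ} {N : ℕ} {x : ℝ} (hx : x ∈ Set.Ico (0 : ℝ) 1) :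
    differenceKernel s b N x = (resolventKernel s x : ℂ) - truncatedKernel b N x := by
  rw [differenceKernel, Int.fract_eq_self.2 hx]

theorem integrableOn_differenceKernel (s b : ℝ) (N : ℕ) :
    IntegrableOn (differenceKernel s b N) (Set.Ico (0 : ℝ) 1) := by
  have h1 := continuous_resolventKernel s
  have h2 := continuous_truncatedKernel b N
  refine (integrableOn_congr_fun (fun x hx => differenceKernel_eq hx) measurableSet_Ico).2 ?_
  exact integrableOn_Ico_of_continuous (by fun_prop)

theorem integral_differenceKernel_mul_e1 {s b : ℝ} (hs : 0 < s)
    (hsb : b = (2 * Real.pi / s) ^ 2) (N : ℕ) (k : ℤ) :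
    ∫ x in Set.Ico (0 : ℝ) 1, differenceKernel s b N x * e1 (-(k : ℝ) * x)
      = if N < k.natAbs then (((1 + b * (k : ℝ) ^ 2)⁻¹ : ℝ) : ℂ) else 0 := by
  have h1 := continuous_resolventKernel s
  have h2 := continuous_truncatedKernel b N
  have hc := continuous_e1
  have e : Set.EqOn (fun x => differenceKernel s b N x * e1 (-(k : ℝ) * x))
      (fun x => (resolventKernel s x : ℂ) * e1 (-(k : ℝ) * x)
        - truncatedKernel b N x * e1 (-(k : ℝ) * x)) (Set.Ico 0 1) := fun x hx => by
    dsimp only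
    rw [differenceKernel_eq hx, sub_mul]
  rw [setIntegral_congr_fun measurableSet_Ico e,
    integral_sub (integrableOn_Ico_of_continuous (by fun_prop))
      (integrableOn_Ico_of_continuous (by fun_prop)),
    integral_resolventKernel_mul_e1 hs, integral_truncatedKernel_mul_e1,
    show 1 + (2 * Real.pi * k / s) ^ 2 = 1 + b * (k : ℝ) ^ 2 by rw [hsb]; ring]
  split_ifs <;> simp

theorem integral_norm_differenceKernel_le {s b : ℝ} (hs : 0 < s) (hb : 0 < b) {N : ℕ}
    (hN : 1 ≤ N) :
    ∫ x in Set.Ico (0 : ℝ) 1, ‖differenceKernel s b N x‖ ≤ 13 * Real.log (N + 2) := by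
  have h1 := continuous_resolventKernel s
  have h2 := continuous_truncatedKernel b N
  have hP : ∫ x in Set.Ico (0 : ℝ) 1, resolventKernel s x = 1 := by
    have := integral_resolventKernel_mul_e1 hs 0
    simp only [Int.cast_zero, neg_zero, zero_mul, e1_zero, mul_one, mul_zero, zero_div] at this
    rw [integral_complex_ofReal] at this
    simpa using this
  have hPi : IntegrableOn (resolventKernel s) (Set.Ico (0 : ℝ) 1) :=
    h1.integrableOn_Icc.mono_set Set.Ico_subset_Icc_self
  have hTi := (integrableOn_Ico_of_continuous h2).norm
  have hlog : 1 ≤ Real.log (N + 2) := by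
    have hN' : (1 : ℝ) ≤ N := by exact_mod_cast hN
    rw [Real.le_log_iff_exp_le (by linarith)]
    linarith [Real.exp_one_lt_d9]
  calc _ ≤ ∫ x in Set.Ico (0 : ℝ) 1, (resolventKernel s x + ‖truncatedKernel b N x‖) := by
        refine setIntegral_mono_on (integrableOn_differenceKernel s b N).norm (hPi.add hTi)
          measurableSet_Ico fun x hx => ?_
        rw [differenceKernel_eq hx]
        refine (norm_sub_le _ _).trans ?_
        rw [Complex.norm_real, Real.norm_eq_abs, abs_of_nonneg (resolventKernel_nonneg hs x)]
    _ = 1 + ∫ x in Set.Ico (0 : ℝ) 1, ‖truncatedKernel b N x‖ := by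
        rw [integral_add hPi hTi, hP]
    _ ≤ _ := by linarith [integral_norm_truncatedKernel_le hb hN]

/-- There exist absolute constants `c₁, c₂ > 0` such that for every `ν > 0`
and every integer `N ≥ 1`, the kernel `K_{>N}` (the L¹ function on `𝕋` whose Fourier
coefficients are `(1 + 4π²ν²k²)⁻¹` for `|k| > N` and `0` otherwise) satisfies
`c₁ (1 + (πNν)²)⁻¹ log (N+2) ≤ ‖K_{>N}‖_{L¹(𝕋)} ≤ c₂ (1 + (πNν)²)⁻¹ log (N+2)`. -/
theorem statement9 :
    ∃ c₁ c₂ : ℝ, 0 < c₁ ∧ 0 < c₂ ∧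
      ∀ ν : ℝ, 0 < ν → ∀ N : ℕ, 1 ≤ N →
        ∃ K : ℝ → ℂ,
          IntegrableOn K (Set.Ico (0 : ℝ) 1) ∧
          (∀ x : ℝ, K (x + 1) = K x) ∧
          (∀ k : ℤ, (N : ℤ) < |k| →
            (∫ x in Set.Ico (0 : ℝ) 1, K x * e1 (-(k : ℝ) * x))
              = (((1 + 4 * Real.pi ^ 2 * ν ^ 2 * (k : ℝ) ^ 2)⁻¹ : ℝ) : ℂ)) ∧
          (∀ k : ℤ, |k| ≤ (N : ℤ) →
            (∫ x in Set.Ico (0 : ℝ) 1, K x * e1 (-(k : ℝ) * x)) = 0) ∧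
          c₁ * (1 + (Real.pi * N * ν) ^ 2)⁻¹ * Real.log ((N : ℝ) + 2)
              ≤ ∫ x in Set.Ico (0 : ℝ) 1, ‖K x‖ ∧
          (∫ x in Set.Ico (0 : ℝ) 1, ‖K x‖)
              ≤ c₂ * (1 + (Real.pi * N * ν) ^ 2)⁻¹ * Real.log ((N : ℝ) + 2) := by
  refine ⟨1 / 192, 20, by norm_num, by norm_num, fun ν hν N hN => ?_⟩
  have hN' : (1 : ℝ) ≤ N := by exact_mod_cast hN
  have hlog : 0 ≤ Real.log ((N : ℝ) + 2) := Real.log_nonneg (by linarith)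
  set b : ℝ := 4 * Real.pi ^ 2 * ν ^ 2 with hb_def
  have hb : 0 < b := by positivity
  set y : ℝ := (Real.pi * N * ν) ^ 2 with hy_def
  have hy : 0 < y := by positivity
  have hby : b * (N : ℝ) ^ 2 = 4 * y := by rw [hb_def, hy_def]; ring
  have lower : ∀ K : ℝ → ℂ, IntegrableOn K (Set.Ico (0 : ℝ) 1) →
      (∀ k : ℤ, (N : ℤ) < |k| → (∫ x in Set.Ico (0 : ℝ) 1, K x * e1 (-(k : ℝ) * x))
        = (((1 + b * (k : ℝ) ^ 2)⁻¹ : ℝ) : ℂ)) →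
      (∀ k : ℤ, |k| ≤ (N : ℤ) → (∫ x in Set.Ico (0 : ℝ) 1, K x * e1 (-(k : ℝ) * x)) = 0) →
      1 / 192 * (1 + y)⁻¹ * Real.log ((N : ℝ) + 2) ≤ ∫ x in Set.Ico (0 : ℝ) 1, ‖K x‖ := by
    intro K hK h1 h2
    have h := le_integral_norm_of_spectral_gap hb hN hK h1 h2
    have h3 : 1 / 16 * (1 + y)⁻¹ ≤ (1 + b * (2 * N) ^ 2)⁻¹ := by
      rw [show b * (2 * N : ℝ) ^ 2 = 4 * (b * N ^ 2) by ring, hby, one_div, ← mul_inv]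
      exact inv_anti₀ (by positivity) (by linarith)
    have h4 := mul_le_mul_of_nonneg_right h3 hlog
    linarith
  rcases le_total (4 * y) 1 with hy1 | hy1
  · have hs : 0 < 1 / ν := by positivity
    have hsb : b = (2 * Real.pi / (1 / ν)) ^ 2 := by rw [hb_def]; field_simp; norm_num
    have hc := integral_differenceKernel_mul_e1 hs hsb N
    have c1 : ∀ k : ℤ, (N : ℤ) < |k| → (∫ x in Set.Ico (0 : ℝ) 1,
        differenceKernel (1 / ν) b N x * e1 (-(k : ℝ) * x))
          = (((1 + b * (k : ℝ) ^ 2)⁻¹ : ℝ) : ℂ) := fun k hk => by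
      rw [Int.abs_eq_natAbs] at hk
      rw [hc, if_pos (by omega)]
    have c2 : ∀ k : ℤ, |k| ≤ (N : ℤ) → (∫ x in Set.Ico (0 : ℝ) 1,
        differenceKernel (1 / ν) b N x * e1 (-(k : ℝ) * x)) = 0 := fun k hk => by
      rw [Int.abs_eq_natAbs] at hk
      rw [hc, if_neg (by omega)]
    have hi := integrableOn_differenceKernel (1 / ν) b N
    refine ⟨differenceKernel (1 / ν) b N, hi, differenceKernel_add_one _ _ _, c1, c2,
      lower _ hi c1 c2, (integral_norm_differenceKernel_le hs hb hN).trans ?_⟩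
    have : 13 ≤ 20 * (1 + y)⁻¹ := by
      rw [← div_eq_mul_inv, le_div_iff₀ (by positivity)]
      linarith
    exact mul_le_mul_of_nonneg_right this hlog
  · have hc := integral_tailKernel_mul_e1 hb hN
    have c1 : ∀ k : ℤ, (N : ℤ) < |k| → (∫ x in Set.Ico (0 : ℝ) 1,
        tailKernel b N x * e1 (-(k : ℝ) * x))
          = (((1 + b * (k : ℝ) ^ 2)⁻¹ : ℝ) : ℂ) := fun k hk => by
      rw [Int.abs_eq_natAbs] at hk
      rw [hc, if_pos (by omega)]
    have c2 : ∀ k : ℤ, |k| ≤ (N : ℤ) → (∫ x in Set.Ico (0 : ℝ) 1,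
        tailKernel b N x * e1 (-(k : ℝ) * x)) = 0 := fun k hk => by
      rw [Int.abs_eq_natAbs] at hk
      rw [hc, if_neg (by omega)]
    have hi := integrableOn_Ico_of_continuous (continuous_tailKernel hb hN)
    refine ⟨tailKernel b N, hi, tailKernel_add_one _ _, c1, c2, lower _ hi c1 c2,
      (integral_norm_tailKernel_le hb hN).trans ?_⟩
    rw [hby]
    have : 4 * (2 * (4 * y)⁻¹) ≤ 20 * (1 + y)⁻¹ := by
      rw [show 4 * (2 * (4 * y)⁻¹) = 2 / y by field_simp, ← div_eq_mul_inv,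
        div_le_div_iff₀ hy (by positivity)]
      linarith
    exact mul_le_mul_of_nonneg_right this hlog

end
end

section
/- Let ν > 0. If N is an integer with N ≥ (1/(2π²ν)) e^{1/(2ν)}, then K_N(x) > 0 for every x ∈ 𝕋 and ‖K_N‖_{L¹(𝕋)} = ∫₀¹ K_N(x) dx = 1. -/
open MeasureTheory

noncomputable section

/-- The truncated kernel `K_N(x) = ∑_{|k| ≤ N} (1 + 4π²ν²k²)⁻¹ e^{2πikx}` on `𝕋`. -/
def KNker (ν : ℝ) (N : ℕ) (x : ℝ) : ℂ :=
  ∑ k ∈ Finset.Icc (-(N : ℤ)) (N : ℤ),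
    (((1 + 4 * Real.pi ^ 2 * ν ^ 2 * (k : ℝ) ^ 2)⁻¹ : ℝ) : ℂ) * e1 ((k : ℝ) * x)

/-- The truncated kernel written as a cosine polynomial. -/
theorem KNker_eq_ofReal (ν : ℝ) (N : ℕ) (x : ℝ) :
    KNker ν N x = ((1 + ∑ k ∈ Finset.range N,
      2 * (1 + 4 * Real.pi ^ 2 * ν ^ 2 * ((k : ℝ) + 1) ^ 2)⁻¹ *
        Real.cos (2 * Real.pi * ((k : ℝ) + 1) * x) : ℝ) : ℂ) := by
  induction N with
  | zero => simp [KNker, e1]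
  | succ N ih =>
    have hIcc : Finset.Icc (-((N + 1 : ℕ) : ℤ)) ((N + 1 : ℕ) : ℤ) =
        insert (-((N : ℤ) + 1)) (insert ((N : ℤ) + 1) (Finset.Icc (-(N : ℤ)) (N : ℤ))) := by
      ext k
      simp only [Finset.mem_Icc, Finset.mem_insert]
      omega
    rw [KNker] at ih ⊢
    rw [hIcc, Finset.sum_insert, Finset.sum_insert, ih, Finset.sum_range_succ]
    · have hcos : e1 ((-((N : ℝ) + 1)) * x) + e1 (((N : ℝ) + 1) * x) =
          2 * ((Real.cos (2 * Real.pi * ((N : ℝ) + 1) * x) : ℝ) : ℂ) := by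
        rw [Complex.ofReal_cos, Complex.two_cos, add_comm]
        simp only [e1]
        congr 2 <;> push_cast <;> ring
      push_cast at hcos ⊢
      rw [neg_sq]
      linear_combination (1 + 4 * (Real.pi : ℂ) ^ 2 * ν ^ 2 * ((N : ℂ) + 1) ^ 2)⁻¹ * hcos
    · simp
    · simp only [Finset.mem_Icc, Finset.mem_insert]
      omega

theorem KNker_im (ν : ℝ) (N : ℕ) (x : ℝ) : (KNker ν N x).im = 0 := by
  rw [KNker_eq_ofReal, Complex.ofReal_im]

theorem ofReal_re_KNker (ν : ℝ) (N : ℕ) (x : ℝ) : (((KNker ν N x).re : ℝ) : ℂ) = KNker ν N x := by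
  rw [KNker_eq_ofReal, Complex.ofReal_re]

theorem re_KNker_succ (ν : ℝ) (N : ℕ) (x : ℝ) :
    (KNker ν (N + 1) x).re = (KNker ν N x).re +
      2 * (1 + 4 * Real.pi ^ 2 * ν ^ 2 * ((N : ℝ) + 1) ^ 2)⁻¹ *
        Real.cos (2 * Real.pi * ((N : ℝ) + 1) * x) := by
  simp only [KNker_eq_ofReal, Complex.ofReal_re, Finset.sum_range_succ]
  ring

theorem integral_re_KNker (ν : ℝ) (N : ℕ) : ∫ x in (0 : ℝ)..1, (KNker ν N x).re = 1 := by
  simp only [KNker_eq_ofReal, Complex.ofReal_re]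
  rw [intervalIntegral.integral_add (by simp)
    (Continuous.intervalIntegrable (by fun_prop) _ _),
    intervalIntegral.integral_finsetSum
      (fun _ _ ↦ Continuous.intervalIntegrable (by fun_prop) _ _)]
  rw [Finset.sum_eq_zero]
  · simp
  · intro k _
    have hc : 2 * Real.pi * ((k : ℝ) + 1) ≠ 0 := by positivity
    rw [intervalIntegral.integral_const_mul, intervalIntegral.integral_comp_mul_left _ hc,
      integral_cos]
    have hs : Real.sin (2 * Real.pi * ((k : ℝ) + 1) * 1) = 0 := by
      rw [show 2 * Real.pi * ((k : ℝ) + 1) * 1 = ((2 * (k + 1) : ℕ) : ℝ) * Real.pi by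
        push_cast; ring]
      exact Real.sin_nat_mul_pi _
    rw [hs, mul_zero, Real.sin_zero, sub_zero, smul_zero, mul_zero]

/-- The `1`-periodic extension of `2 cosh (a (x - 1/2))` from `[0, 1)`. -/
def periodicCosh (a : ℝ) : C(AddCircle (1 : ℝ), ℂ) where
  toFun := AddCircle.liftIco 1 0 fun x ↦ ((2 * Real.cosh (a * (x - 1 / 2)) : ℝ) : ℂ)
  continuous_toFun := by
    refine AddCircle.liftIco_zero_continuous ?_ (Continuous.continuousOn (by fun_prop))
    rw [← Real.cosh_neg]
    congr 3
    ring

theorem periodicCosh_coe (a : ℝ) {x : ℝ} (hx : x ∈ Set.Ico (0 : ℝ) 1) :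
    periodicCosh a (x : AddCircle (1 : ℝ)) = ((2 * Real.cosh (a * (x - 1 / 2)) : ℝ) : ℂ) :=
  AddCircle.liftIco_coe_apply
    (f := fun x : ℝ ↦ ((2 * Real.cosh (a * (x - 1 / 2)) : ℝ) : ℂ)) (by simpa using hx)

theorem two_le_re_periodicCosh (a : ℝ) (y : AddCircle (1 : ℝ)) : 2 ≤ (periodicCosh a y).re := by
  obtain ⟨x, hx, rfl⟩ : y ∈ ((↑) : ℝ → AddCircle (1 : ℝ)) '' Set.Ico 0 (0 + 1) := by
    rw [AddCircle.coe_image_Ico_eq]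
    trivial
  rw [zero_add] at hx
  rw [periodicCosh_coe a hx, Complex.ofReal_re]
  linarith [Real.one_le_cosh (a * (x - 1 / 2))]

theorem fourierCoeff_periodicCosh {a : ℝ} (ha : 0 < a) (n : ℤ) :
    fourierCoeff (periodicCosh a) n =
      ((4 * Real.sinh (a / 2) / a * (1 + 4 * Real.pi ^ 2 * a⁻¹ ^ 2 * (n : ℝ) ^ 2)⁻¹ : ℝ) : ℂ) := by
  have hp : (a : ℂ) - 2 * Real.pi * Complex.I * n ≠ 0 := by
    intro h
    apply ha.ne'
    simpa using congrArg Complex.re h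
  have hm : -(a : ℂ) - 2 * Real.pi * Complex.I * n ≠ 0 := by
    intro h
    apply ha.ne'
    simpa using congrArg Complex.re h
  have hper : Complex.exp (-(2 * Real.pi * Complex.I * n)) = 1 := by
    rw [Complex.exp_neg, mul_comm, Complex.exp_int_mul_two_pi_mul_I, inv_one]
  have hint : ∀ x ∈ Set.Ioo (0 : ℝ) 1,
      fourier (-n) (x : AddCircle (1 : ℝ)) • periodicCosh a (x : AddCircle (1 : ℝ)) =
        Complex.exp (-(a / 2)) * Complex.exp ((a - 2 * Real.pi * Complex.I * n) * x) +
        Complex.exp (a / 2) * Complex.exp ((-a - 2 * Real.pi * Complex.I * n) * x) := by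
    intro x hx
    rw [periodicCosh_coe a (Set.Ioo_subset_Ico_self hx), fourier_coe_apply, smul_eq_mul]
    push_cast
    rw [Complex.two_cosh, mul_add, ← Complex.exp_add, ← Complex.exp_add, ← Complex.exp_add,
      ← Complex.exp_add]
    congr 2 <;> ring
  rw [fourierCoeff_eq_intervalIntegral _ _ 0, zero_add,
    intervalIntegral.integral_congr_Ioo_of_le zero_le_one hint,
    intervalIntegral.integral_add (Continuous.intervalIntegrable (by fun_prop) _ _)
      (Continuous.intervalIntegrable (by fun_prop) _ _),
    intervalIntegral.integral_const_mul, intervalIntegral.integral_const_mul,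
    integral_exp_mul_complex hp, integral_exp_mul_complex hm]
  have hE : Complex.exp ((a - 2 * Real.pi * Complex.I * n) * (1 : ℝ)) =
      Complex.exp (a / 2) * Complex.exp (a / 2) := by
    rw [← Complex.exp_add, ← mul_one (Complex.exp (a / 2 + a / 2)), ← hper, ← Complex.exp_add]
    congr 1
    push_cast
    ring
  have hE' : Complex.exp ((-a - 2 * Real.pi * Complex.I * n) * (1 : ℝ)) =
      Complex.exp (-(a / 2)) * Complex.exp (-(a / 2)) := by
    rw [← Complex.exp_add, ← mul_one (Complex.exp (-(a / 2) + -(a / 2))), ← hper,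
      ← Complex.exp_add]
    congr 1
    push_cast
    ring
  have hprod : Complex.exp (a / 2) * Complex.exp (-(a / 2)) = 1 := by
    rw [← Complex.exp_add, add_neg_cancel, Complex.exp_zero]
  have hsinh : (2 : ℂ) * Complex.sinh (a / 2) = Complex.exp (a / 2) - Complex.exp (-(a / 2)) :=
    Complex.two_sinh _
  have hden : (a : ℂ) ^ 2 + 4 * Real.pi ^ 2 * n ^ 2 ≠ 0 := by
    have : a ^ 2 + 4 * Real.pi ^ 2 * (n : ℝ) ^ 2 ≠ 0 := by positivity
    exact_mod_cast this
  have ha' : (a : ℂ) ≠ 0 := by exact_mod_cast ha.ne'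
  have hcoeff : (1 + 4 * (Real.pi : ℂ) ^ 2 * (a : ℂ)⁻¹ ^ 2 * (n : ℂ) ^ 2)⁻¹ =
      (a : ℂ) ^ 2 / ((a : ℂ) ^ 2 + 4 * (Real.pi : ℂ) ^ 2 * n ^ 2) := by
    rw [inv_eq_iff_eq_inv, inv_div]
    field_simp
  rw [hE, hE']
  push_cast
  rw [hcoeff, show (4 : ℂ) * Complex.sinh (a / 2) = 2 * (2 * Complex.sinh (a / 2)) by ring, hsinh]
  simp only [mul_zero, Complex.exp_zero, div_one, one_smul]
  generalize Complex.exp (a / 2) = u at *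
  generalize Complex.exp (-(a / 2)) = v at *
  have hu : v * ((u * u - 1) / (a - 2 * Real.pi * Complex.I * n)) =
      (u - v) / (a - 2 * Real.pi * Complex.I * n) := by
    rw [← mul_div_assoc]
    congr 1
    linear_combination u * hprod
  have hv : u * ((v * v - 1) / (-a - 2 * Real.pi * Complex.I * n)) =
      (v - u) / (-a - 2 * Real.pi * Complex.I * n) := by
    rw [← mul_div_assoc]
    congr 1
    linear_combination v * hprod
  rw [hu, hv, div_add_div _ _ hp hm, div_mul_div_comm,
    div_eq_div_iff (mul_ne_zero hp hm) (mul_ne_zero ha' hden)]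
  linear_combination (-8 * (a : ℂ) ^ 2 * (u - v) * (Real.pi : ℂ) ^ 2 * n ^ 2) * Complex.I_sq

theorem summable_inv_one_add_mul_sq {c : ℝ} (hc : 0 < c) :
    Summable fun n : ℤ ↦ (1 + c * (n : ℝ) ^ 2)⁻¹ := by
  refine Summable.of_norm_bounded_eventually
    ((Real.summable_one_div_int_pow.mpr one_lt_two).mul_left c⁻¹) ?_
  filter_upwards [(Set.finite_singleton (0 : ℤ)).compl_mem_cofinite] with n hn
  have hn : (n : ℝ) ≠ 0 := by exact_mod_cast hn
  rw [Real.norm_of_nonneg (by positivity), one_div, ← mul_inv]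
  exact inv_anti₀ (by positivity) (by linarith)

theorem tendsto_KNker {ν : ℝ} (hν : 0 < ν) (x : ℝ) :
    Filter.Tendsto (fun N ↦ (4 * Real.sinh (ν⁻¹ / 2) * ν : ℝ) * (KNker ν N x).re) Filter.atTop
      (nhds (periodicCosh ν⁻¹ (x : AddCircle (1 : ℝ))).re) := by
  have hcoeff := fourierCoeff_periodicCosh (inv_pos.mpr hν)
  simp only [inv_inv, div_inv_eq_mul] at hcoeff
  have hsum : Summable (fourierCoeff (periodicCosh ν⁻¹)) := by
    rw [funext hcoeff]
    exact Complex.ofRealCLM.summable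
      ((summable_inv_one_add_mul_sq (by positivity)).mul_left _)
  have h := (has_pointwise_sum_fourier_series_of_summable hsum (x : AddCircle (1 : ℝ))).comp
    Finset.tendsto_Icc_neg
  refine ((Complex.continuous_re.tendsto _).comp h).congr fun N ↦ ?_
  simp only [Function.comp_apply]
  rw [← Complex.re_ofReal_mul, KNker, Finset.mul_sum]
  congr 1
  refine Finset.sum_congr rfl fun k _ ↦ ?_
  rw [hcoeff, fourier_coe_apply, e1, smul_eq_mul, Complex.ofReal_mul, mul_assoc]
  congr 3
  push_cast
  ring

theorem antitone_re_KNker_add {ν : ℝ} (hν : 0 < ν) (x : ℝ) :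
    AntitoneOn (fun N : ℕ ↦ (KNker ν N x).re + 1 / (2 * Real.pi ^ 2 * ν ^ 2) / N)
      (Set.Ici 1) := by
  refine antitoneOn_nat_Ici_of_succ_le fun N hN ↦ ?_
  have hN : (0 : ℝ) < N := by exact_mod_cast hN
  have hπ := Real.pi_pos
  rw [re_KNker_succ]
  have h1 : 2 * (1 + 4 * Real.pi ^ 2 * ν ^ 2 * ((N : ℝ) + 1) ^ 2)⁻¹ *
      Real.cos (2 * Real.pi * ((N : ℝ) + 1) * x) ≤
      2 * (4 * Real.pi ^ 2 * ν ^ 2 * (N * ((N : ℝ) + 1)))⁻¹ := by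
    refine (mul_le_of_le_one_right (by positivity) (Real.cos_le_one _)).trans ?_
    gcongr
    nlinarith [show 0 < 4 * Real.pi ^ 2 * ν ^ 2 * ((N : ℝ) + 1) by positivity]
  have h2 : 2 * (4 * Real.pi ^ 2 * ν ^ 2 * (N * ((N : ℝ) + 1)))⁻¹ +
      1 / (2 * Real.pi ^ 2 * ν ^ 2) / ((N + 1 : ℕ) : ℝ) =
      1 / (2 * Real.pi ^ 2 * ν ^ 2) / N := by
    push_cast
    field_simp
    ring
  linarith

theorem le_re_KNker {ν : ℝ} (hν : 0 < ν) {N : ℕ} (hN : 1 ≤ N) (x : ℝ) :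
    1 / (2 * ν * Real.sinh (ν⁻¹ / 2)) - 1 / (2 * Real.pi ^ 2 * ν ^ 2) / N ≤ (KNker ν N x).re := by
  have hS : 0 < 4 * Real.sinh (ν⁻¹ / 2) * ν := by
    have := Real.sinh_pos_iff.mpr (show 0 < ν⁻¹ / 2 by positivity)
    positivity
  have hlim := (tendsto_KNker hν x).const_mul (4 * Real.sinh (ν⁻¹ / 2) * ν)⁻¹
  simp only [inv_mul_cancel_left₀ hS.ne'] at hlim
  have hlim := hlim.add
    (tendsto_const_div_atTop_nhds_zero_nat (1 / (2 * Real.pi ^ 2 * ν ^ 2)))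
  have h := le_of_tendsto hlim <| by
    filter_upwards [Filter.eventually_ge_atTop N] with M hM
    exact antitone_re_KNker_add hν x hN (hN.trans hM) hM
  have h2 : (4 * Real.sinh (ν⁻¹ / 2) * ν)⁻¹ * 2 ≤
      (4 * Real.sinh (ν⁻¹ / 2) * ν)⁻¹ * (periodicCosh ν⁻¹ (x : AddCircle (1 : ℝ))).re := by
    gcongr
    exact two_le_re_periodicCosh _ _
  have h3 : 1 / (2 * ν * Real.sinh (ν⁻¹ / 2)) = (4 * Real.sinh (ν⁻¹ / 2) * ν)⁻¹ * 2 := by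
    have := hS.ne'
    field_simp
    norm_num
  linarith

theorem re_KNker_pos {ν : ℝ} (hν : 0 < ν) {N : ℕ}
    (hN : 1 / (2 * Real.pi ^ 2 * ν) * Real.exp (1 / (2 * ν)) ≤ (N : ℝ)) (x : ℝ) :
    0 < (KNker ν N x).re := by
  have hN0 : (0 : ℝ) < N := lt_of_lt_of_le (by positivity) hN
  have hS : 0 < Real.sinh (ν⁻¹ / 2) := Real.sinh_pos_iff.mpr (by positivity)
  have hlt : 2 * Real.sinh (ν⁻¹ / 2) < Real.exp (1 / (2 * ν)) := by
    rw [show 1 / (2 * ν) = ν⁻¹ / 2 by field_simp, Real.sinh_eq]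
    linarith [Real.exp_pos (-(ν⁻¹ / 2))]
  refine lt_of_lt_of_le (sub_pos.mpr ?_) (le_re_KNker hν (by exact_mod_cast hN0) x)
  rw [div_div, one_div_lt_one_div (by positivity) (by positivity)]
  calc 2 * ν * Real.sinh (ν⁻¹ / 2) = ν * (2 * Real.sinh (ν⁻¹ / 2)) := by ring
    _ < ν * Real.exp (1 / (2 * ν)) := by gcongr
    _ = 2 * Real.pi ^ 2 * ν ^ 2 *
        (1 / (2 * Real.pi ^ 2 * ν) * Real.exp (1 / (2 * ν))) := by field_simp
    _ ≤ 2 * Real.pi ^ 2 * ν ^ 2 * N := by gcongr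

/-- Let `ν > 0`. If `N ≥ (1/(2π²ν)) e^{1/(2ν)}`, then `K_N(x) > 0` for
every `x ∈ 𝕋` and `‖K_N‖_{L¹(𝕋)} = ∫₀¹ K_N(x) dx = 1`. -/
theorem statement11 (ν : ℝ) (hν : 0 < ν) (N : ℕ)
    (hN : 1 / (2 * Real.pi ^ 2 * ν) * Real.exp (1 / (2 * ν)) ≤ (N : ℝ)) :
    (∀ x : ℝ, (KNker ν N x).im = 0 ∧ 0 < (KNker ν N x).re) ∧
    (∫ x in Set.Ico (0 : ℝ) 1, KNker ν N x) = 1 ∧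
    (∫ x in Set.Ico (0 : ℝ) 1, ‖KNker ν N x‖) = 1 := by
  have hpos := re_KNker_pos hν hN
  have hint : ∫ x in Set.Ico (0 : ℝ) 1, (KNker ν N x).re = 1 := by
    rw [integral_Ico_eq_integral_Ioc, ← intervalIntegral.integral_of_le zero_le_one,
      integral_re_KNker]
  refine ⟨fun x ↦ ⟨KNker_im ν N x, hpos x⟩, ?_, ?_⟩
  · rw [← funext (ofReal_re_KNker ν N), integral_complex_ofReal, hint, Complex.ofReal_one]
  · have hnorm (x : ℝ) : ‖KNker ν N x‖ = (KNker ν N x).re := by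
      rw [← ofReal_re_KNker, Complex.norm_of_nonneg (hpos x).le, Complex.ofReal_re]
    simp_rw [hnorm, hint]

end
end
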